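/- arXiv:0804.0034 — 3 statements merged into one kernel-verified Lean document; each statement's English description precedes it below -/
import Mathlib

section
/- Let n ≥ 3. There is a constant C = C(n) such that for every measurable W : ℝ^n → ℝ satisfying |W(x)| ≤ M ⟨x⟩^{-2} for all x, and every Schwartz function f on ℝ^n, ∫_ℝ ∫_{ℝ^n} |W(x)| |(e^{itΔ}f)(x)|² dx dt ≤ C M ‖f‖²_{L²(ℝ^n)}. Equivalently, the multiplication operator by |W|^{1/2} is a smoothing bound for the free Schrödinger evolution: ‖ |W|^{1/2} e^{itΔ} f ‖_{L²(ℝ×ℝ^n)} ≤ (CM)^{1/2} ‖f‖_{L²}. -/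
open MeasureTheory ENNReal SchwartzMap

/-- The free Schrödinger evolution `(e^{itΔ}f)(x)`, given for `t ≠ 0` by the
explicit convolution formula with the principal branch of the complex power. -/
noncomputable def schrod (n : ℕ) (t : ℝ) (f : EuclideanSpace ℝ (Fin n) → ℂ)
    (x : EuclideanSpace ℝ (Fin n)) : ℂ :=
  if t = 0 then f x
  else (4 * Real.pi * Complex.I * (t : ℂ)) ^ (-(n : ℂ) / 2) *
    ∫ y : EuclideanSpace ℝ (Fin n),
      Complex.exp (Complex.I * (‖x - y‖ : ℂ) ^ 2 / (4 * (t : ℂ))) * f y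

theorem lintegral_comp_affine_le (g : ℝ → ℝ≥0∞) {b : ℝ} (hb : b ≠ 0) (c : ℝ) :
    ∫⁻ x, ENNReal.ofReal |b| * g (b * x + c) ≤ ∫⁻ u, g u := by
  have h := lintegral_image_eq_lintegral_abs_deriv_mul (s := Set.univ) (f := fun x => b * x + c)
    (f' := fun _ => b) MeasurableSet.univ
    (fun x _ => by
      simpa only [mul_one] using
        (((hasDerivAt_id' x).const_mul b).add_const c).hasDerivWithinAt)
    (fun x _ y _ h => by simpa [hb] using h) g
  rw [setLIntegral_univ] at h
  rw [← h]
  exact setLIntegral_le_lintegral _ _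

theorem setLIntegral_comp_quadratic_le {g : ℝ → ℝ≥0∞} (hgm : Measurable g)
    (hg : ∀ u v, |u| ≤ |v| → g v ≤ g u) (a : ℝ) :
    ∫⁻ ρ in Set.Ioi (0 : ℝ), ENNReal.ofReal ρ * g (ρ ^ 2 + 2 * a * ρ) ≤ 4 * ∫⁻ u, g u := by
  set b : ℝ := max (-a) 0 with hb
  have hb0 : 0 ≤ b := le_max_right _ _
  have hab : -a ≤ b := le_max_left _ _
  have hfar : ∫⁻ ρ in Set.Ioi (2 * b), ENNReal.ofReal ρ * g (ρ ^ 2 + 2 * a * ρ) ≤ ∫⁻ u, g u := by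
    have h := lintegral_image_eq_lintegral_abs_deriv_mul (s := Set.Ioi (2 * b))
      (f := fun x => x ^ 2 + 2 * a * x) (f' := fun x => 2 * x + 2 * a) measurableSet_Ioi
      (fun x _ => by
        convert! (((hasDerivAt_id' x).fun_pow 2).fun_add
          ((hasDerivAt_id' x).const_mul (2 * a))).hasDerivWithinAt using 1
        simp)
      (fun x hx y hy h => by
        simp only [Set.mem_Ioi] at hx hy h
        have h1 : (x - y) * (x + y + 2 * a) = 0 := by linear_combination h
        rcases mul_eq_zero.1 h1 with h2 | h2 <;> linarith) g
    calc _ ≤ ∫⁻ x in Set.Ioi (2 * b),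
          ENNReal.ofReal |2 * x + 2 * a| * g (x ^ 2 + 2 * a * x) := by
          refine setLIntegral_mono' measurableSet_Ioi fun x hx => ?_
          rw [Set.mem_Ioi] at hx
          gcongr
          exact le_trans (by linarith) (le_abs_self _)
      _ ≤ _ := by
          rw [← h]
          exact setLIntegral_le_lintegral _ _
  have hnear : ∫⁻ ρ in Set.Ioc 0 (2 * b), ENNReal.ofReal ρ * g (ρ ^ 2 + 2 * a * ρ)
      ≤ 3 * ∫⁻ u, g u := by
    rcases hb0.eq_or_lt with h0 | h0
    · simp [← h0]
    have hba : a = -b := by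
      rcases max_cases (-a) 0 with h | h
      · linarith [h.1]
      · linarith [h.1]
    calc _ ≤ ∫⁻ ρ in Set.Ioc 0 (2 * b), (ENNReal.ofReal |b| * g (b * ρ + 0)
            + 2 * (ENNReal.ofReal |-b| * g (-b * ρ + 2 * b ^ 2))) := by
          refine setLIntegral_mono' measurableSet_Ioc fun x hx => ?_
          obtain ⟨hx0, hx1⟩ := hx
          rw [abs_neg, abs_of_pos h0]
          have habs : |x ^ 2 + 2 * a * x| = x * (2 * b - x) := by
            rw [hba, abs_of_nonpos (by nlinarith)]
            ring
          rcases le_total x b with hxb | hxb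
          · refine le_trans ?_ (le_add_of_nonneg_right zero_le)
            gcongr
            apply hg
            rw [habs, abs_of_nonneg (by positivity)]
            nlinarith
          · refine le_trans ?_ (le_add_of_nonneg_left zero_le)
            rw [← mul_assoc]
            gcongr
            · rw [← ENNReal.ofReal_ofNat 2, ← ENNReal.ofReal_mul (by norm_num)]
              exact ENNReal.ofReal_le_ofReal hx1
            · apply hg
              rw [habs, abs_of_nonneg (by nlinarith)]
              nlinarith
      _ ≤ ∫⁻ ρ, (ENNReal.ofReal |b| * g (b * ρ + 0)
            + 2 * (ENNReal.ofReal |-b| * g (-b * ρ + 2 * b ^ 2))) :=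
          setLIntegral_le_lintegral _ _
      _ ≤ (∫⁻ u, g u) + 2 * ∫⁻ u, g u := by
          rw [lintegral_add_left (by fun_prop), lintegral_const_mul 2 (by fun_prop)]
          exact add_le_add (lintegral_comp_affine_le g h0.ne' 0)
            (mul_le_mul_right (lintegral_comp_affine_le g (neg_ne_zero.2 h0.ne') _) 2)
      _ = _ := by ring
  calc _ ≤ ∫⁻ ρ in Set.Ioc 0 (2 * b) ∪ Set.Ioi (2 * b),
        ENNReal.ofReal ρ * g (ρ ^ 2 + 2 * a * ρ) := by
        apply lintegral_mono_set
        rw [Set.Ioc_union_Ioi_eq_Ioi (by positivity)]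
    _ ≤ _ := lintegral_union_le _ _ _
    _ ≤ 3 * (∫⁻ u, g u) + ∫⁻ u, g u := by gcongr
    _ = _ := by ring

/-- The superposition over `s > 0` of the Fourier transforms of the Gaussians `e^{-s|x|²}` on a
`d`-dimensional space, at a point with squared norm `q`. -/
noncomputable def gaussianSuperposition (d : ℕ) (q : ℝ) : ℝ≥0∞ :=
  ∫⁻ s in Set.Ioi (0 : ℝ), ENNReal.ofReal ((Real.pi / s) ^ ((d : ℝ) / 2) * Real.exp (-q / (4 * s)))

theorem gaussianSuperposition_sq_mul {d : ℕ} (hd : 1 ≤ d) {ρ : ℝ} (hρ : 0 < ρ) :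
    ENNReal.ofReal (ρ ^ (d - 1)) * gaussianSuperposition d (ρ ^ 2)
      = ENNReal.ofReal ρ * gaussianSuperposition d 1 := by
  have himg : (fun s : ℝ => ρ ^ 2 * s) '' Set.Ioi 0 = Set.Ioi 0 := by
    simp [Set.image_mul_left_Ioi, hρ]
  have h := lintegral_image_eq_lintegral_abs_deriv_mul (s := Set.Ioi 0)
    (f := fun s => ρ ^ 2 * s) (f' := fun _ => ρ ^ 2) measurableSet_Ioi
    (fun x _ => by simpa using ((hasDerivAt_id' x).const_mul (ρ ^ 2)).hasDerivWithinAt)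
    (fun x _ y _ h => by simpa [hρ.ne'] using h)
    (fun s => ENNReal.ofReal ((Real.pi / s) ^ ((d : ℝ) / 2) * Real.exp (-ρ ^ 2 / (4 * s))))
  rw [himg] at h
  unfold gaussianSuperposition
  rw [h, ← lintegral_const_mul _ (by fun_prop), ← lintegral_const_mul _ (by fun_prop)]
  refine setLIntegral_congr_fun measurableSet_Ioi fun s hs => ?_
  rw [Set.mem_Ioi] at hs
  have hpi := Real.pi_pos
  rw [abs_of_pos (by positivity), ← ENNReal.ofReal_mul (by positivity),
    ← ENNReal.ofReal_mul (by positivity), ← ENNReal.ofReal_mul (by positivity)]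
  congr 1
  have e1 : -ρ ^ 2 / (4 * (ρ ^ 2 * s)) = -1 / (4 * s) := by field_simp
  have e2 : (Real.pi / (ρ ^ 2 * s)) ^ ((d : ℝ) / 2)
      = (Real.pi / s) ^ ((d : ℝ) / 2) / ρ ^ d := by
    rw [show Real.pi / (ρ ^ 2 * s) = Real.pi / s / ρ ^ 2 by field_simp,
      Real.div_rpow (by positivity) (by positivity), ← Real.rpow_natCast ρ 2, ← Real.rpow_mul hρ.le]
    congr 1
    rw [← Real.rpow_natCast ρ d]
    congr 1
    push_cast
    ring
  rw [e1, e2]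
  obtain ⟨k, rfl⟩ : ∃ k, d = k + 1 := ⟨d - 1, by omega⟩
  simp only [Nat.add_sub_cancel, pow_succ ρ k]
  field_simp

theorem gaussianSuperposition_one_ne_top {d : ℕ} (hd : 3 ≤ d) :
    gaussianSuperposition d 1 ≠ ⊤ := by
  have hpi := Real.pi_pos
  have hd' : (3 : ℝ) ≤ d := by exact_mod_cast hd
  refine (lt_of_le_of_lt (b := (∫⁻ _ in Set.Ioc (0 : ℝ) 1,
      ENNReal.ofReal ((4 * Real.pi) ^ d * d.factorial)) + ∫⁻ s in Set.Ioi (1 : ℝ),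
      ENNReal.ofReal (Real.pi ^ ((d : ℝ) / 2) * s ^ (-((d : ℝ) / 2)))) ?_ ?_).ne
  · unfold gaussianSuperposition
    rw [← Set.Ioc_union_Ioi_eq_Ioi zero_le_one]
    refine (lintegral_union_le _ _ _).trans (add_le_add ?_ ?_)
    · refine setLIntegral_mono' measurableSet_Ioc fun s hs => ENNReal.ofReal_le_ofReal ?_
      obtain ⟨hs0, hs1⟩ := hs
      have h1 : 1 ≤ Real.pi / s := by
        rw [le_div_iff₀ hs0]
        linarith [Real.pi_gt_three]
      have h2 : (Real.pi / s) ^ ((d : ℝ) / 2) ≤ (Real.pi / s) ^ d := by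
        rw [← Real.rpow_natCast (Real.pi / s) d]
        exact Real.rpow_le_rpow_of_exponent_le h1 (by linarith)
      have h3 := Real.pow_div_factorial_le_exp (1 / (4 * s)) (by positivity) d
      have hf : (0 : ℝ) < d.factorial := by positivity
      rw [div_le_iff₀ hf] at h3
      rw [neg_div, Real.exp_neg, ← div_eq_mul_inv, div_le_iff₀ (Real.exp_pos _)]
      calc _ ≤ _ := h2
        _ = (4 * Real.pi) ^ d * (1 / (4 * s)) ^ d := by
          rw [← mul_pow]
          congr 1
          field_simp
        _ ≤ (4 * Real.pi) ^ d * (Real.exp (1 / (4 * s)) * d.factorial) := by gcongr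
        _ = _ := by ring
    · refine setLIntegral_mono' measurableSet_Ioi fun s hs => ENNReal.ofReal_le_ofReal ?_
      have hs0 : 0 < s := lt_trans zero_lt_one hs
      rw [Real.div_rpow hpi.le hs0.le, Real.rpow_neg hs0.le, ← div_eq_mul_inv]
      refine mul_le_of_le_one_right (by positivity) (Real.exp_le_one_iff.2 ?_)
      exact div_nonpos_of_nonpos_of_nonneg (by norm_num) (by positivity)
  · refine ENNReal.add_lt_top.2 ⟨by simp, ?_⟩
    have hi := (integrableOn_Ioi_rpow_of_lt (a := -((d : ℝ) / 2)) (by linarith)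
      zero_lt_one).const_mul (Real.pi ^ ((d : ℝ) / 2))
    exact hi.lintegral_lt_top

theorem lintegral_eq_lintegral_toSphere {E : Type*} [NormedAddCommGroup E] [NormedSpace ℝ E]
    [FiniteDimensional ℝ E] [MeasurableSpace E] [BorelSpace E] [Nontrivial E]
    (μ : Measure E) [μ.IsAddHaarMeasure] {F : E → ℝ≥0∞} (hF : Measurable F) :
    ∫⁻ x, F x ∂μ = ∫⁻ ω, (∫⁻ r in Set.Ioi (0 : ℝ),
      ENNReal.ofReal (r ^ (Module.finrank ℝ E - 1)) * F (r • (ω : E))) ∂μ.toSphere := by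
  calc ∫⁻ x, F x ∂μ = ∫⁻ x : ({(0)}ᶜ : Set E), F x.1 ∂(μ.comap (↑)) := by
        rw [lintegral_subtype_comap (measurableSet_singleton _).compl F,
          restrict_compl_singleton]
    _ = ∫⁻ z, F (z.2.1 • (z.1 : E))
        ∂μ.toSphere.prod (Measure.volumeIoiPow (Module.finrank ℝ E - 1)) := by
      rw [← μ.measurePreserving_homeomorphUnitSphereProd.lintegral_comp_emb
        (Homeomorph.measurableEmbedding _)]
      refine lintegral_congr fun x => ?_
      congr 1
      have : ‖x.1‖ ≠ 0 := norm_ne_zero_iff.2 x.2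
      simp [smul_smul, this]
    _ = _ := by
      rw [lintegral_prod _ (by fun_prop)]
      refine lintegral_congr fun ω => ?_
      rw [Measure.volumeIoiPow, lintegral_withDensity_eq_lintegral_mul _ (by fun_prop)
        (by fun_prop)]
      exact lintegral_subtype_comap measurableSet_Ioi
        (fun r : ℝ => ENNReal.ofReal (r ^ (Module.finrank ℝ E - 1)) * F (r • (ω : E)))

/-- A weighted `L²` bound for an integral operator with bounded kernel `φ` through the kernel of
its composition with its adjoint. -/
theorem lintegral_ofReal_mul_enorm_integral_sq_le {Ω Y : Type*} [MeasurableSpace Ω]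
    [MeasurableSpace Y] (μ : Measure Ω) [SFinite μ] (ν : Measure Y) [SFinite ν] {g : Ω → ℝ}
    (hg : Integrable g μ) (hg0 : ∀ ω, 0 ≤ g ω) {φ : Ω → Y → ℂ}
    (hφ : Measurable (Function.uncurry φ)) (hφ1 : ∀ ω y, ‖φ ω y‖ ≤ 1) {f : Y → ℂ}
    (hf : Integrable f ν) :
    ∫⁻ ω, ENNReal.ofReal (g ω) * ‖∫ y, φ ω y * f y ∂ν‖ₑ ^ 2 ∂μ
      ≤ ∫⁻ y, ∫⁻ z, ‖f y‖ₑ * ‖f z‖ₑ *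
          ‖∫ ω, (g ω : ℂ) * (φ ω y * (starRingEnd ℂ) (φ ω z)) ∂μ‖ₑ ∂ν ∂ν := by
  set A : Ω → ℂ := fun ω => ∫ y, φ ω y * f y ∂ν with hA
  let H : Ω → Y × Y → ℂ := fun ω p =>
    (g ω : ℂ) * ((φ ω p.1 * f p.1) * (starRingEnd ℂ) (φ ω p.2 * f p.2))
  have hconj : Integrable (fun y => (starRingEnd ℂ) (f y)) ν :=
    (Complex.conjCLE.toContinuousLinearMap.integrable_comp hf)
  have hHint : Integrable (Function.uncurry H) (μ.prod (ν.prod ν)) := by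
    have h1 : Integrable (fun q : Ω × (Y × Y) =>
        (g q.1 : ℂ) * (f q.2.1 * (starRingEnd ℂ) (f q.2.2))) (μ.prod (ν.prod ν)) :=
      hg.ofReal.mul_prod (hf.mul_prod hconj)
    have hm1 : Measurable (fun q : Ω × (Y × Y) => φ q.1 q.2.1) :=
      hφ.comp (measurable_fst.prodMk (measurable_fst.comp measurable_snd))
    have hm2 : Measurable (fun q : Ω × (Y × Y) => φ q.1 q.2.2) :=
      hφ.comp (measurable_fst.prodMk (measurable_snd.comp measurable_snd))
    have h2 := h1.bdd_mul (c := 1) (f := fun q : Ω × (Y × Y) =>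
        φ q.1 q.2.1 * (starRingEnd ℂ) (φ q.1 q.2.2))
      (hm1.mul (Complex.continuous_conj.measurable.comp hm2)).aestronglyMeasurable
      (Filter.Eventually.of_forall fun q => by
        rw [norm_mul, RCLike.norm_conj]
        exact mul_le_one₀ (hφ1 _ _) (norm_nonneg _) (hφ1 _ _))
    refine h2.congr (Filter.Eventually.of_forall fun q => ?_)
    simp only [Function.uncurry, H, map_mul]
    ring
  have hHA : ∀ ω, ∫ p, H ω p ∂(ν.prod ν) = ((g ω * ‖A ω‖ ^ 2 : ℝ) : ℂ) := by
    intro ω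
    simp only [H]
    rw [integral_const_mul, integral_prod_mul (fun y => φ ω y * f y)
      (fun y => (starRingEnd ℂ) (φ ω y * f y)), integral_conj, Complex.mul_conj]
    push_cast [Complex.normSq_eq_norm_sq]
    rfl
  have hint : Integrable (fun ω => g ω * ‖A ω‖ ^ 2) μ := by
    have := hHint.integral_prod_left.re
    refine this.congr (Filter.Eventually.of_forall fun ω => ?_)
    simp only [Function.uncurry]
    rw [show (∫ y, H ω y ∂(ν.prod ν)) = _ from hHA ω]
    exact Complex.ofReal_re _
  calc ∫⁻ ω, ENNReal.ofReal (g ω) * ‖A ω‖ₑ ^ 2 ∂μ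
      = ∫⁻ ω, ENNReal.ofReal (g ω * ‖A ω‖ ^ 2) ∂μ := by
        refine lintegral_congr fun ω => ?_
        rw [ENNReal.ofReal_mul (hg0 ω), ENNReal.ofReal_pow (norm_nonneg _), ofReal_norm]
    _ = ENNReal.ofReal (∫ ω, g ω * ‖A ω‖ ^ 2 ∂μ) :=
        (ofReal_integral_eq_lintegral_ofReal hint (Filter.Eventually.of_forall fun ω =>
          mul_nonneg (hg0 ω) (by positivity))).symm
    _ ≤ ‖∫ ω, ∫ p, H ω p ∂(ν.prod ν) ∂μ‖ₑ := by
        simp_rw [hHA]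
        rw [integral_complex_ofReal, ← ofReal_norm]
        refine ENNReal.ofReal_le_ofReal ?_
        rw [Complex.norm_real]
        exact le_abs_self _
    _ = ‖∫ p, ∫ ω, H ω p ∂μ ∂(ν.prod ν)‖ₑ := by rw [integral_integral_swap hHint]
    _ ≤ ∫⁻ p, ‖∫ ω, H ω p ∂μ‖ₑ ∂(ν.prod ν) := enorm_integral_le_lintegral_enorm _
    _ = ∫⁻ y, ∫⁻ z, ‖∫ ω, H ω (y, z) ∂μ‖ₑ ∂ν ∂ν :=
        lintegral_prod _ hHint.integral_prod_right.aestronglyMeasurable.enorm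
    _ = _ := by
        refine lintegral_congr fun y => lintegral_congr fun z => ?_
        rw [show ‖f z‖ₑ = ‖(starRingEnd ℂ) (f z)‖ₑ by
          rw [← ofReal_norm, ← ofReal_norm, RCLike.norm_conj], ← enorm_mul, ← enorm_mul,
          ← integral_const_mul]
        congr 2
        ext ω
        simp only [H, map_mul]
        ring

/-- The superposition `∫₀^∞ e^{-s r²} ds`, which is `r⁻²` for `r ≠ 0`. -/
noncomputable def inverseSquareWeight (r : ℝ) : ℝ≥0∞ :=
  ∫⁻ s in Set.Ioi (0 : ℝ), ENNReal.ofReal (Real.exp (-s * r ^ 2))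

theorem measurable_inverseSquareWeight : Measurable inverseSquareWeight := by
  unfold inverseSquareWeight
  exact Measurable.lintegral_prod_right' (f := fun q : ℝ × ℝ => ENNReal.ofReal
    (Real.exp (-q.2 * q.1 ^ 2))) (by fun_prop)

theorem ofReal_inv_add_sq_le_inverseSquareWeight {δ : ℝ} (hδ : 0 < δ) (r : ℝ) :
    ENNReal.ofReal (δ + r ^ 2)⁻¹ ≤ inverseSquareWeight r := by
  have hneg : -(δ + r ^ 2) < 0 := by
    have := sq_nonneg r
    linarith
  have h := integral_exp_mul_Ioi hneg 0
  rw [mul_zero, Real.exp_zero, div_neg, neg_div, neg_neg, one_div] at h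
  rw [← h, ofReal_integral_eq_lintegral_ofReal (integrableOn_exp_mul_Ioi hneg 0)
    (Filter.Eventually.of_forall fun s => by positivity)]
  refine setLIntegral_mono' measurableSet_Ioi fun s hs =>
    ENNReal.ofReal_le_ofReal (Real.exp_le_exp.2 ?_)
  rw [Set.mem_Ioi] at hs
  nlinarith [mul_pos hs hδ]

section ChirpTransform

variable {E : Type*} [NormedAddCommGroup E] [InnerProductSpace ℝ E] [FiniteDimensional ℝ E]
  [MeasurableSpace E] [BorelSpace E]

/-- The Fourier transform of `f` multiplied by the quadratic phase `e^{iτ|y|²}`. -/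
noncomputable def chirpTransform (f : E → ℂ) (τ : ℝ) (p : E) : ℂ :=
  ∫ y, Complex.exp (Complex.I * (τ * ‖y‖ ^ 2 - inner ℝ p y : ℝ)) * f y

theorem measurable_chirpTransform {f : E → ℂ} (hf : Measurable f) :
    Measurable (Function.uncurry (chirpTransform f)) := by
  have h : Measurable (fun q : (ℝ × E) × E =>
      Complex.exp (Complex.I * (q.1.1 * ‖q.2‖ ^ 2 - inner ℝ q.1.2 q.2 : ℝ)) * f q.2) := by
    have : Measurable (fun q : (ℝ × E) × E => inner ℝ q.1.2 q.2) :=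
      (by fun_prop : Continuous (fun q : (ℝ × E) × E => inner ℝ q.1.2 q.2)).measurable
    fun_prop
  exact h.stronglyMeasurable.integral_prod_right'.measurable

theorem measurable_chirpTransform_right {f : E → ℂ} (hf : Measurable f) (τ : ℝ) :
    Measurable (chirpTransform f τ) :=
  (measurable_chirpTransform hf).of_uncurry_left

/-- The Fourier transform of the Gaussian `e^{-εt²}` at frequency `u`. -/
noncomputable def timeGaussian (ε u : ℝ) : ℝ≥0∞ :=
  ENNReal.ofReal ((Real.pi / ε) ^ (1 / 2 : ℝ) * Real.exp (-u ^ 2 / (4 * ε)))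

theorem measurable_timeGaussian (ε : ℝ) : Measurable (timeGaussian ε) := by
  unfold timeGaussian
  fun_prop

theorem timeGaussian_anti {ε : ℝ} (hε : 0 < ε) {u v : ℝ} (h : |u| ≤ |v|) :
    timeGaussian ε v ≤ timeGaussian ε u := by
  unfold timeGaussian
  have := sq_le_sq.2 h
  gcongr

theorem timeGaussian_neg (ε u : ℝ) : timeGaussian ε (-u) = timeGaussian ε u := by
  simp [timeGaussian]

theorem lintegral_timeGaussian {ε : ℝ} (hε : 0 < ε) :
    ∫⁻ u, timeGaussian ε u = ENNReal.ofReal (2 * Real.pi) := by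
  have hpi := Real.pi_pos
  have he : ∀ u : ℝ, (Real.pi / ε) ^ (1 / 2 : ℝ) * Real.exp (-u ^ 2 / (4 * ε))
      = (Real.pi / ε) ^ (1 / 2 : ℝ) * Real.exp (-(1 / (4 * ε)) * u ^ 2) := by
    intro u
    congr 2
    ring
  unfold timeGaussian
  simp_rw [he]
  rw [← ofReal_integral_eq_lintegral_ofReal
    ((integrable_exp_neg_mul_sq (by positivity)).const_mul _)
    (Filter.Eventually.of_forall fun u => by positivity), integral_const_mul, integral_gaussian,
    ← Real.sqrt_eq_rpow, ← Real.sqrt_mul (by positivity)]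
  congr 1
  rw [show Real.pi / ε * (Real.pi / (1 / (4 * ε))) = (2 * Real.pi) ^ 2 by field_simp; ring]
  exact Real.sqrt_sq (by positivity)

theorem enorm_integral_gaussian_oscillation {ε : ℝ} (hε : 0 < ε) {s : ℝ} (hs : 0 < s) (y z : E) :
    ‖∫ q : ℝ × E, ((Real.exp (-ε * q.1 ^ 2) * Real.exp (-s * ‖q.2‖ ^ 2) : ℝ) : ℂ) *
        (Complex.exp (Complex.I * (q.1 * ‖y‖ ^ 2 - inner ℝ q.2 y : ℝ)) *
          (starRingEnd ℂ) (Complex.exp (Complex.I * (q.1 * ‖z‖ ^ 2 - inner ℝ q.2 z : ℝ))))‖ₑ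
      = timeGaussian ε (‖z‖ ^ 2 - ‖y‖ ^ 2) * ENNReal.ofReal
          ((Real.pi / s) ^ ((Module.finrank ℝ E : ℝ) / 2) * Real.exp (-‖z - y‖ ^ 2 / (4 * s))) := by
  have hsplit : ∀ q : ℝ × E,
      ((Real.exp (-ε * q.1 ^ 2) * Real.exp (-s * ‖q.2‖ ^ 2) : ℝ) : ℂ) *
        (Complex.exp (Complex.I * (q.1 * ‖y‖ ^ 2 - inner ℝ q.2 y : ℝ)) *
          (starRingEnd ℂ) (Complex.exp (Complex.I * (q.1 * ‖z‖ ^ 2 - inner ℝ q.2 z : ℝ))))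
      = Complex.exp (-(ε : ℂ) * ((‖q.1‖ : ℝ) : ℂ) ^ 2 +
            Complex.I * (inner ℝ (‖y‖ ^ 2 - ‖z‖ ^ 2) q.1 : ℝ)) *
          Complex.exp (-(s : ℂ) * ((‖q.2‖ : ℝ) : ℂ) ^ 2 +
            Complex.I * (inner ℝ (z - y) q.2 : ℝ)) := by
    intro q
    rw [← Complex.exp_conj, ← Real.exp_add, Complex.ofReal_exp, ← Complex.exp_add,
      ← Complex.exp_add, ← Complex.exp_add]
    congr 1
    have h1 : ((‖q.1‖ : ℝ) : ℂ) ^ 2 = (q.1 : ℂ) ^ 2 := by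
      rw [← Complex.ofReal_pow, Real.norm_eq_abs, sq_abs, Complex.ofReal_pow]
    rw [h1, inner_sub_left (𝕜 := ℝ) z y, real_inner_comm y, real_inner_comm z]
    simp only [map_mul, Complex.conj_I, Complex.conj_ofReal, RCLike.inner_apply, conj_trivial]
    push_cast
    ring
  have hpi := Real.pi_pos
  have hre : ∀ (b u v : ℝ), 0 < b →
      ‖((Real.pi : ℂ) / b) ^ ((u : ℂ) / 2) * Complex.exp (Complex.I ^ 2 * (v : ℂ) ^ 2 / (4 * b))‖ₑ
        = ENNReal.ofReal ((Real.pi / b) ^ (u / 2) * Real.exp (-v ^ 2 / (4 * b))) := by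
    intro b u v hb
    rw [← ofReal_norm, norm_mul, show ((Real.pi : ℂ) / b) ^ ((u : ℂ) / 2)
        = (((Real.pi / b) ^ (u / 2) : ℝ) : ℂ) by
          rw [Complex.ofReal_cpow (by positivity)]; push_cast; rfl,
      show Complex.I ^ 2 * (v : ℂ) ^ 2 / (4 * b) = ((-v ^ 2 / (4 * b) : ℝ) : ℂ) by
        rw [Complex.I_sq]; push_cast; ring, ← Complex.ofReal_exp, Complex.norm_real,
      Complex.norm_real, Real.norm_of_nonneg (by positivity), Real.norm_of_nonneg (by positivity)]
  simp_rw [hsplit]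
  rw [Measure.volume_eq_prod, integral_prod_mul
    (fun t : ℝ => Complex.exp (-(ε : ℂ) * ((‖t‖ : ℝ) : ℂ) ^ 2 +
            Complex.I * (inner ℝ (‖y‖ ^ 2 - ‖z‖ ^ 2) t : ℝ)))
    (fun p : E => Complex.exp (-(s : ℂ) * ((‖p‖ : ℝ) : ℂ) ^ 2 +
            Complex.I * (inner ℝ (z - y) p : ℝ))),
    GaussianFourier.integral_cexp_neg_mul_sq_norm_add (by simpa using hε),
    GaussianFourier.integral_cexp_neg_mul_sq_norm_add (by simpa using hs), enorm_mul]
  congr 1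
  · have := hre ε 1 ‖‖y‖ ^ 2 - ‖z‖ ^ 2‖ hε
    rw [Module.finrank_self, Nat.cast_one, ← Complex.ofReal_one, this, timeGaussian,
      Real.norm_eq_abs, sq_abs, ← neg_sub (‖y‖ ^ 2), neg_sq]
  · simpa only [Complex.ofReal_natCast] using hre s (Module.finrank ℝ E) ‖z - y‖ hs

theorem measurable_gaussianSuperposition (d : ℕ) : Measurable (gaussianSuperposition d) := by
  unfold gaussianSuperposition
  exact Measurable.lintegral_prod_right' (f := fun q : ℝ × ℝ => ENNReal.ofReal
    ((Real.pi / q.2) ^ ((d : ℝ) / 2) * Real.exp (-q.1 / (4 * q.2)))) (by fun_prop)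

theorem lintegral_timeGaussian_mul_gaussianSuperposition_le (hE : 3 ≤ Module.finrank ℝ E) {ε : ℝ}
    (hε : 0 < ε) (y : E) :
    ∫⁻ z, timeGaussian ε (‖z‖ ^ 2 - ‖y‖ ^ 2) *
        gaussianSuperposition (Module.finrank ℝ E) (‖z - y‖ ^ 2)
      ≤ gaussianSuperposition (Module.finrank ℝ E) 1 * (4 * ENNReal.ofReal (2 * Real.pi)) *
          (volume : Measure E).toSphere Set.univ := by
  have hgm := measurable_timeGaussian ε
  have hkm := measurable_gaussianSuperposition (Module.finrank ℝ E)
  have : Nontrivial E := Module.nontrivial_of_finrank_pos (R := ℝ) (by omega)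
  rw [← lintegral_add_left_eq_self _ y, lintegral_eq_lintegral_toSphere _ (by fun_prop),
    ← lintegral_const]
  refine lintegral_mono fun ω => ?_
  have hω : ‖(ω : E)‖ = 1 := by simp
  calc _ = ∫⁻ r in Set.Ioi (0 : ℝ), gaussianSuperposition (Module.finrank ℝ E) 1 *
          (ENNReal.ofReal r * timeGaussian ε (r ^ 2 + 2 * inner ℝ y (ω : E) * r)) := by
        refine setLIntegral_congr_fun measurableSet_Ioi fun r hr => ?_
        rw [Set.mem_Ioi] at hr
        have h1 : ‖y + r • (ω : E)‖ ^ 2 - ‖y‖ ^ 2 = r ^ 2 + 2 * inner ℝ y (ω : E) * r := by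
          rw [norm_add_sq_real, norm_smul, hω, inner_smul_right, Real.norm_eq_abs, mul_one, sq_abs]
          ring
        have h2 : ‖y + r • (ω : E) - y‖ ^ 2 = r ^ 2 := by
          rw [add_sub_cancel_left, norm_smul, hω, Real.norm_eq_abs, mul_one, sq_abs]
        rw [h1, h2, mul_left_comm, gaussianSuperposition_sq_mul (by omega) hr]
        ring
    _ ≤ _ := by
        rw [lintegral_const_mul _ (by fun_prop), ← lintegral_timeGaussian hε]
        gcongr
        exact setLIntegral_comp_quadratic_le hgm (fun u v => timeGaussian_anti hε) _

/-- The constant in the space-time bound for `chirpTransform`. -/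
noncomputable def smoothingConstant (E : Type*) [NormedAddCommGroup E] [InnerProductSpace ℝ E]
    [FiniteDimensional ℝ E] [MeasurableSpace E] [BorelSpace E] : ℝ≥0∞ :=
  2 * (gaussianSuperposition (Module.finrank ℝ E) 1 * (4 * ENNReal.ofReal (2 * Real.pi)) *
    (volume : Measure E).toSphere Set.univ)

theorem smoothingConstant_ne_top (hE : 3 ≤ Module.finrank ℝ E) : smoothingConstant E ≠ ⊤ := by
  unfold smoothingConstant
  have := gaussianSuperposition_one_ne_top hE
  finiteness

theorem lintegral_gaussian_mul_chirpTransform_le (hE : 3 ≤ Module.finrank ℝ E) {f : E → ℂ}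
    (hfm : Measurable f) (hf : Integrable f) {ε : ℝ} (hε : 0 < ε) :
    ∫⁻ q : ℝ × E, ENNReal.ofReal (Real.exp (-ε * q.1 ^ 2)) *
        (inverseSquareWeight ‖q.2‖ * ‖chirpTransform f q.1 q.2‖ₑ ^ 2)
      ≤ smoothingConstant E * ∫⁻ y, ‖f y‖ₑ ^ 2 := by
  have hVm : Measurable fun q : ℝ × E => chirpTransform f q.1 q.2 :=
    measurable_chirpTransform hfm
  have hgm := measurable_timeGaussian ε
  have hkm := measurable_gaussianSuperposition (Module.finrank ℝ E)
  let K : E → E → ℝ≥0∞ := fun y z => timeGaussian ε (‖z‖ ^ 2 - ‖y‖ ^ 2) *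
    gaussianSuperposition (Module.finrank ℝ E) (‖z - y‖ ^ 2)
  have hKm : Measurable (Function.uncurry K) := by
    simp only [K, Function.uncurry_def]
    fun_prop
  have hKsymm : ∀ y z, K y z = K z y := fun y z => by
    simp only [K]
    rw [← neg_sub (‖y‖ ^ 2), timeGaussian_neg, norm_sub_rev]
  have hK : ∀ y, ∫⁻ z, K y z ≤ _ := fun y =>
    lintegral_timeGaussian_mul_gaussianSuperposition_le hE hε y
  have hphase : Measurable (Function.uncurry fun (q : ℝ × E) (y : E) =>
      Complex.exp (Complex.I * (q.1 * ‖y‖ ^ 2 - inner ℝ q.2 y : ℝ))) := by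
    simp only [Function.uncurry_def]
    exact (by fun_prop : Continuous fun q : (ℝ × E) × E =>
      Complex.exp (Complex.I * (q.1.1 * ‖q.2‖ ^ 2 - inner ℝ q.1.2 q.2 : ℝ))).measurable
  calc _ = ∫⁻ q : ℝ × E, ∫⁻ s in Set.Ioi (0 : ℝ), ENNReal.ofReal
          (Real.exp (-ε * q.1 ^ 2) * Real.exp (-s * ‖q.2‖ ^ 2)) *
            ‖chirpTransform f q.1 q.2‖ₑ ^ 2 := by
        refine lintegral_congr fun q => ?_
        rw [inverseSquareWeight, ← lintegral_mul_const _ (by fun_prop),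
          ← lintegral_const_mul _ (by fun_prop)]
        refine lintegral_congr fun s => ?_
        rw [ENNReal.ofReal_mul (Real.exp_pos _).le, mul_assoc]
    _ = ∫⁻ s in Set.Ioi (0 : ℝ), ∫⁻ q : ℝ × E, ENNReal.ofReal
          (Real.exp (-ε * q.1 ^ 2) * Real.exp (-s * ‖q.2‖ ^ 2)) *
            ‖chirpTransform f q.1 q.2‖ₑ ^ 2 := by
        refine lintegral_lintegral_swap (Measurable.aemeasurable ?_)
        simp only [Function.uncurry_def]
        fun_prop
    _ ≤ ∫⁻ s in Set.Ioi (0 : ℝ), ∫⁻ y, ∫⁻ z, ‖f y‖ₑ * ‖f z‖ₑ *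
          (timeGaussian ε (‖z‖ ^ 2 - ‖y‖ ^ 2) * ENNReal.ofReal
          ((Real.pi / s) ^ ((Module.finrank ℝ E : ℝ) / 2) *
            Real.exp (-‖z - y‖ ^ 2 / (4 * s)))) := by
        refine setLIntegral_mono' measurableSet_Ioi fun s hs => ?_
        rw [Set.mem_Ioi] at hs
        have hint : Integrable (fun q : ℝ × E =>
            Real.exp (-ε * q.1 ^ 2) * Real.exp (-s * ‖q.2‖ ^ 2)) := by
          refine (integrable_exp_neg_mul_sq hε).mul_prod (f := fun t : ℝ => Real.exp (-ε * t ^ 2))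
            (g := fun p : E => Real.exp (-s * ‖p‖ ^ 2)) ?_
          have h0 := (GaussianFourier.integrable_cexp_neg_mul_sq_norm_add
            (V := E) (b := s) (by simpa using hs) 0 0).re
          refine h0.congr (Filter.Eventually.of_forall fun p => ?_)
          simp only [zero_mul, add_zero]
          rw [← Complex.ofReal_pow, ← Complex.ofReal_neg, ← Complex.ofReal_mul,
            ← Complex.ofReal_exp]
          exact Complex.ofReal_re _
        refine (lintegral_ofReal_mul_enorm_integral_sq_le volume volume hint
          (fun q => by positivity) hphase (fun q y => ?_) hf).trans_eq ?_
        · rw [Complex.norm_exp_I_mul_ofReal]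
        · simp_rw [enorm_integral_gaussian_oscillation hε hs]
    _ = ∫⁻ y, ∫⁻ z, ‖f y‖ₑ * ‖f z‖ₑ * K y z := by
        rw [lintegral_lintegral_swap]
        · refine lintegral_congr fun y => ?_
          rw [lintegral_lintegral_swap]
          · refine lintegral_congr fun z => ?_
            rw [lintegral_const_mul _ (by fun_prop), lintegral_const_mul _ (by fun_prop)]
            rfl
          · refine Measurable.aemeasurable ?_
            simp only [Function.uncurry_def]
            fun_prop
        · refine (Measurable.lintegral_prod_right' (f := fun q : (ℝ × E) × E =>
            ‖f q.1.2‖ₑ * ‖f q.2‖ₑ *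
            (timeGaussian ε (‖q.2‖ ^ 2 - ‖q.1.2‖ ^ 2) * ENNReal.ofReal
            ((Real.pi / q.1.1) ^ ((Module.finrank ℝ E : ℝ) / 2) *
            Real.exp (-‖q.2 - q.1.2‖ ^ 2 / (4 * q.1.1))))) ?_).aemeasurable
          fun_prop
    _ ≤ ∫⁻ y, ∫⁻ z, (‖f y‖ₑ ^ 2 * K y z + ‖f z‖ₑ ^ 2 * K y z) := by
        refine lintegral_mono fun y => lintegral_mono fun z => ?_
        rw [← add_mul]
        gcongr
        rcases le_total ‖f y‖ₑ ‖f z‖ₑ with h | h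
        · refine le_trans ?_ (le_add_of_nonneg_left zero_le)
          rw [sq]
          gcongr
        · refine le_trans ?_ (le_add_of_nonneg_right zero_le)
          rw [sq]
          gcongr
    _ = 2 * ∫⁻ y, ‖f y‖ₑ ^ 2 * ∫⁻ z, K y z := by
        have hKm' : Measurable fun q : E × E => K q.1 q.2 := hKm
        have hl : ∀ y, ∫⁻ z, ‖f y‖ₑ ^ 2 * K y z = ‖f y‖ₑ ^ 2 * ∫⁻ z, K y z := fun y =>
          lintegral_const_mul _ (by fun_prop)
        have hr : ∫⁻ y, ∫⁻ z, ‖f z‖ₑ ^ 2 * K y z = ∫⁻ y, ‖f y‖ₑ ^ 2 * ∫⁻ z, K y z := by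
          rw [lintegral_lintegral_swap]
          · refine lintegral_congr fun y => ?_
            simp_rw [fun z => hKsymm z y]
            exact hl y
          · refine Measurable.aemeasurable ?_
            simp only [Function.uncurry_def]
            fun_prop
        have hs : ∀ y, ∫⁻ z, (‖f y‖ₑ ^ 2 * K y z + ‖f z‖ₑ ^ 2 * K y z)
            = ‖f y‖ₑ ^ 2 * (∫⁻ z, K y z) + ∫⁻ z, ‖f z‖ₑ ^ 2 * K y z := fun y => by
          rw [lintegral_add_left (by fun_prop), hl]
        simp_rw [hs]
        rw [lintegral_add_left, hr, two_mul]
        exact (hfm.enorm.pow_const 2).mul (Measurable.lintegral_prod_right' hKm')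
    _ ≤ 2 * ∫⁻ y, ‖f y‖ₑ ^ 2 * (gaussianSuperposition (Module.finrank ℝ E) 1 *
          (4 * ENNReal.ofReal (2 * Real.pi)) * (volume : Measure E).toSphere Set.univ) := by
        gcongr with y
        exact hK y
    _ = _ := by
        rw [lintegral_mul_const _ (by fun_prop), smoothingConstant]
        ring

theorem lintegral_inverseSquareWeight_mul_chirpTransform_le (hE : 3 ≤ Module.finrank ℝ E)
    {f : E → ℂ} (hfm : Measurable f) (hf : Integrable f) :
    ∫⁻ τ : ℝ, ∫⁻ p : E, inverseSquareWeight ‖p‖ * ‖chirpTransform f τ p‖ₑ ^ 2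
      ≤ smoothingConstant E * ∫⁻ y, ‖f y‖ₑ ^ 2 := by
  have hVm : Measurable fun q : ℝ × E => chirpTransform f q.1 q.2 :=
    measurable_chirpTransform hfm
  have hwm := measurable_inverseSquareWeight
  rw [← lintegral_prod (fun q : ℝ × E => inverseSquareWeight ‖q.2‖ * ‖chirpTransform f q.1 q.2‖ₑ ^ 2)
    (Measurable.aemeasurable (by fun_prop)), ← Measure.volume_eq_prod]
  refine le_of_tendsto' (lintegral_tendsto_of_tendsto_of_monotone
    (f := fun (k : ℕ) (q : ℝ × E) => ENNReal.ofReal (Real.exp (-(1 / ((k : ℝ) + 1)) * q.1 ^ 2)) *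
        (inverseSquareWeight ‖q.2‖ * ‖chirpTransform f q.1 q.2‖ₑ ^ 2)) (fun k => ?_)
    (Filter.Eventually.of_forall fun q k l hkl => ?_)
    (Filter.Eventually.of_forall fun q => ?_))
    fun k => lintegral_gaussian_mul_chirpTransform_le hE hfm hf (by positivity)
  · exact Measurable.aemeasurable (by fun_prop)
  · dsimp only
    gcongr
  · have h1 : Filter.Tendsto (fun k : ℕ => ENNReal.ofReal
        (Real.exp (-(1 / ((k : ℝ) + 1)) * q.1 ^ 2))) Filter.atTop (nhds 1) := by
      have h2 := (tendsto_one_div_add_atTop_nhds_zero_nat (𝕜 := ℝ)).neg.mul_const (q.1 ^ 2)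
      have h3 := ENNReal.tendsto_ofReal ((Real.continuous_exp.tendsto _).comp h2)
      simpa using h3
    simpa using ENNReal.Tendsto.mul_const h1 (Or.inl one_ne_zero)

end ChirpTransform

theorem lintegral_comp_smul {E : Type*} [NormedAddCommGroup E] [NormedSpace ℝ E]
    [FiniteDimensional ℝ E] [MeasurableSpace E] [BorelSpace E] (μ : Measure E)
    [μ.IsAddHaarMeasure] (h : E → ℝ≥0∞) {r : ℝ} (hr : r ≠ 0) :
    ∫⁻ x, h (r • x) ∂μ = ENNReal.ofReal |(r ^ Module.finrank ℝ E)⁻¹| * ∫⁻ x, h x ∂μ := by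
  rw [← smul_eq_mul, ← lintegral_smul_measure, ← Measure.map_addHaar_smul μ hr]
  exact (lintegral_map_equiv h (Homeomorph.smulOfNeZero r hr).toMeasurableEquiv).symm

theorem enorm_schrod_smul_sq {n : ℕ} {t : ℝ} (ht : t ≠ 0) (f : EuclideanSpace ℝ (Fin n) → ℂ)
    (p : EuclideanSpace ℝ (Fin n)) :
    ‖schrod n t f ((2 * t) • p)‖ₑ ^ 2
      = ENNReal.ofReal ((4 * Real.pi * |t|) ^ n)⁻¹ * ‖chirpTransform f (1 / (4 * t)) p‖ₑ ^ 2 := by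
  have hpi := Real.pi_pos
  have ht' : (t : ℂ) ≠ 0 := by exact_mod_cast ht
  have hI := Complex.I_ne_zero
  have hbase : (4 * Real.pi * Complex.I * (t : ℂ)) ≠ 0 := by
    have : (Real.pi : ℂ) ≠ 0 := by exact_mod_cast hpi.ne'
    simp [*]
  have hpow : ‖(4 * Real.pi * Complex.I * (t : ℂ)) ^ (-(n : ℂ) / 2)‖ ^ 2
      = ((4 * Real.pi * |t|) ^ n)⁻¹ := by
    have hexp : (-(n : ℂ) / 2) = ((-(n : ℝ) / 2 : ℝ) : ℂ) := by push_cast; rfl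
    rw [hexp, Complex.norm_cpow_real]
    simp only [norm_mul, Complex.norm_I, Complex.norm_real, Real.norm_eq_abs, mul_one,
      Complex.norm_ofNat, abs_of_pos hpi]
    rw [← Real.rpow_natCast _ 2, ← Real.rpow_mul (by positivity), ← Real.rpow_natCast _ n,
      ← Real.rpow_neg (by positivity)]
    congr 1
    push_cast
    ring
  have hint : (∫ y, Complex.exp (Complex.I * (‖(2 * t) • p - y‖ : ℂ) ^ 2 / (4 * (t : ℂ))) * f y)
      = Complex.exp ((t * ‖p‖ ^ 2 : ℝ) * Complex.I) * chirpTransform f (1 / (4 * t)) p := by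
    rw [chirpTransform, ← integral_const_mul]
    refine integral_congr_ae (Filter.Eventually.of_forall fun y => ?_)
    dsimp only
    rw [← mul_assoc, ← Complex.exp_add]
    congr 2
    rw [← Complex.ofReal_pow, norm_sub_sq_real, norm_smul, inner_smul_left, mul_pow,
      Real.norm_eq_abs, sq_abs]
    simp only [conj_trivial]
    push_cast
    field_simp
    ring
  rw [schrod, if_neg ht, hint, enorm_mul, enorm_mul, mul_pow, mul_pow, ← hpow,
    ENNReal.ofReal_pow (norm_nonneg _), ofReal_norm, ← ofReal_norm (Complex.exp _),
    Complex.norm_exp_ofReal_mul_I, ENNReal.ofReal_one, one_pow, one_mul]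

theorem ofReal_abs_smul_le_inverseSquareWeight {E : Type*} [NormedAddCommGroup E]
    [NormedSpace ℝ E] {t : ℝ} (ht : t ≠ 0) {M : ℝ} {W : E → ℝ}
    (hW : ∀ x, |W x| ≤ M * (1 + ‖x‖ ^ 2)⁻¹) (p : E) :
    ENNReal.ofReal |W ((2 * t) • p)|
      ≤ ENNReal.ofReal (M * (1 / (4 * t ^ 2))) * inverseSquareWeight ‖p‖ := by
  have hM : 0 ≤ M := by
    have h := (abs_nonneg _).trans (hW 0)
    simpa using h
  refine le_trans ?_ (mul_le_mul_right (ofReal_inv_add_sq_le_inverseSquareWeight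
    (δ := 1 / (4 * t ^ 2)) (by positivity) ‖p‖) _)
  rw [← ENNReal.ofReal_mul (by positivity)]
  refine ENNReal.ofReal_le_ofReal ((hW _).trans_eq ?_)
  rw [norm_smul, mul_pow, Real.norm_eq_abs, sq_abs]
  field_simp
  ring

theorem lintegral_mul_enorm_schrod_sq_le {n : ℕ} {t : ℝ} (ht : t ≠ 0) {M : ℝ}
    {W : EuclideanSpace ℝ (Fin n) → ℝ} (hW : ∀ x, |W x| ≤ M * (1 + ‖x‖ ^ 2)⁻¹)
    {f : EuclideanSpace ℝ (Fin n) → ℂ} (hf : Measurable f) :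
    ∫⁻ x, ENNReal.ofReal |W x| * ‖schrod n t f x‖ₑ ^ 2
      ≤ ENNReal.ofReal M * ENNReal.ofReal ((2 * Real.pi) ^ n)⁻¹ *
        (ENNReal.ofReal |-(4 / (4 * t) ^ 2)| *
          ∫⁻ p, inverseSquareWeight ‖p‖ * ‖chirpTransform f (1 / (4 * t)) p‖ₑ ^ 2) := by
  have hpi := Real.pi_pos
  have hM : 0 ≤ M := by
    have h := (abs_nonneg _).trans (hW 0)
    simpa using h
  have h2t : 2 * t ≠ 0 := by simpa using ht
  have hVm := measurable_chirpTransform_right hf (1 / (4 * t))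
  have hwm := measurable_inverseSquareWeight
  have hscale := lintegral_comp_smul volume
    (fun x => ENNReal.ofReal |W x| * ‖schrod n t f x‖ₑ ^ 2) h2t
  rw [finrank_euclideanSpace_fin, abs_inv, abs_pow] at hscale
  have hpow : 0 < |2 * t| ^ n := by positivity
  have hback : ∫⁻ x, ENNReal.ofReal |W x| * ‖schrod n t f x‖ₑ ^ 2
      = ENNReal.ofReal (|2 * t| ^ n) * ∫⁻ p, ENNReal.ofReal |W ((2 * t) • p)| *
          ‖schrod n t f ((2 * t) • p)‖ₑ ^ 2 := by
    rw [hscale, ← mul_assoc, ← ENNReal.ofReal_mul hpow.le, mul_inv_cancel₀ hpow.ne',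
      ENNReal.ofReal_one, one_mul]
  rw [hback]
  calc _ ≤ ENNReal.ofReal (|2 * t| ^ n) * ∫⁻ p,
        (ENNReal.ofReal (M * (1 / (4 * t ^ 2))) * ENNReal.ofReal ((4 * Real.pi * |t|) ^ n)⁻¹) *
          (inverseSquareWeight ‖p‖ * ‖chirpTransform f (1 / (4 * t)) p‖ₑ ^ 2) := by
        refine mul_le_mul_right (lintegral_mono fun p => ?_) _
        rw [enorm_schrod_smul_sq ht, mul_mul_mul_comm]
        exact mul_le_mul_left (ofReal_abs_smul_le_inverseSquareWeight ht hW p) _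
    _ = _ := by
        rw [lintegral_const_mul _ (by fun_prop), ← mul_assoc,
          ← mul_assoc (ENNReal.ofReal M * ENNReal.ofReal _)]
        congr 1
        rw [← ENNReal.ofReal_mul (by positivity), ← ENNReal.ofReal_mul (by positivity),
          ← ENNReal.ofReal_mul hM,
          ← ENNReal.ofReal_mul (by positivity)]
        congr 1
        rw [abs_neg, abs_of_nonneg (show (0 : ℝ) ≤ 4 / (4 * t) ^ 2 by positivity), abs_mul, abs_two,
          show 4 * Real.pi * |t| = (2 * Real.pi) * (2 * |t|) by ring, mul_pow (2 * Real.pi)]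
        field_simp

theorem lintegral_inv_four_mul_le (h : ℝ → ℝ≥0∞) :
    ∫⁻ t in ({0}ᶜ : Set ℝ), ENNReal.ofReal |-(4 / (4 * t) ^ 2)| * h (1 / (4 * t))
      ≤ ∫⁻ τ, h τ := by
  have hc := lintegral_image_eq_lintegral_abs_deriv_mul (s := ({0}ᶜ : Set ℝ))
    (f := fun t => 1 / (4 * t)) (f' := fun t => -(4 / (4 * t) ^ 2))
    (measurableSet_singleton 0).compl
    (fun t ht => by
      have ht0 : 4 * t ≠ 0 := by simpa using ht
      have h1 := (((hasDerivAt_id' t).const_mul 4).fun_inv ht0).hasDerivWithinAt (s := {0}ᶜ)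
      simpa only [one_div, mul_one, neg_div] using h1)
    (fun x hx y hy hxy => by simpa using hxy) h
  rw [← hc]
  exact setLIntegral_le_lintegral _ _

/-- Kato smoothing: for a potential with quadratic decay `|W(x)| ≤ M⟨x⟩⁻²`,
`∫∫ |W(x)| |e^{itΔ}f(x)|² dx dt ≤ C M ‖f‖²_{L²}`, i.e. multiplication by
`|W|^{1/2}` is a smoothing bound for the free Schrödinger evolution. -/
theorem kato_smoothing_quadratic_decay (n : ℕ) (hn : 3 ≤ n) :
    ∃ C : ℝ≥0∞, C ≠ ⊤ ∧
      ∀ (M : ℝ) (W : EuclideanSpace ℝ (Fin n) → ℝ), Measurable W →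
        (∀ x, |W x| ≤ M * (1 + ‖x‖ ^ 2)⁻¹) →
        ∀ f : 𝓢(EuclideanSpace ℝ (Fin n), ℂ),
          (∫⁻ t : ℝ, ∫⁻ x : EuclideanSpace ℝ (Fin n),
              ENNReal.ofReal |W x| * (‖schrod n t (⇑f) x‖₊ : ℝ≥0∞) ^ 2)
            ≤ C * ENNReal.ofReal M * (eLpNorm (⇑f) 2 volume) ^ 2 := by
  have hE : 3 ≤ Module.finrank ℝ (EuclideanSpace ℝ (Fin n)) := by simpa using hn
  refine ⟨ENNReal.ofReal ((2 * Real.pi) ^ n)⁻¹ * smoothingConstant (EuclideanSpace ℝ (Fin n)),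
    ENNReal.mul_ne_top ENNReal.ofReal_ne_top (smoothingConstant_ne_top hE), fun M W _ hW f => ?_⟩
  have hfm : Measurable f := f.continuous.measurable
  have hnorm : eLpNorm f 2 volume ^ 2 = ∫⁻ y, ‖f y‖ₑ ^ 2 := by
    have h := eLpNorm_nnreal_pow_eq_lintegral (p := 2) (f := f) (μ := volume) two_ne_zero
    simpa using h
  calc _ = ∫⁻ t in ({0}ᶜ : Set ℝ), ∫⁻ x, ENNReal.ofReal |W x| * ‖schrod n t f x‖ₑ ^ 2 := by
        rw [restrict_compl_singleton]
        rfl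
    _ ≤ ∫⁻ t in ({0}ᶜ : Set ℝ), ENNReal.ofReal M * ENNReal.ofReal ((2 * Real.pi) ^ n)⁻¹ *
        (ENNReal.ofReal |-(4 / (4 * t) ^ 2)| *
          ∫⁻ p, inverseSquareWeight ‖p‖ * ‖chirpTransform f (1 / (4 * t)) p‖ₑ ^ 2) :=
        setLIntegral_mono' (measurableSet_singleton 0).compl fun t ht =>
          lintegral_mul_enorm_schrod_sq_le ht hW hfm
    _ ≤ ENNReal.ofReal M * ENNReal.ofReal ((2 * Real.pi) ^ n)⁻¹ *
        ∫⁻ τ, ∫⁻ p, inverseSquareWeight ‖p‖ * ‖chirpTransform f τ p‖ₑ ^ 2 := by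
        rw [lintegral_const_mul' _ _ (by finiteness)]
        refine mul_le_mul_right ?_ _
        exact lintegral_inv_four_mul_le
          fun τ => ∫⁻ p, inverseSquareWeight ‖p‖ * ‖chirpTransform f τ p‖ₑ ^ 2
    _ ≤ ENNReal.ofReal M * ENNReal.ofReal ((2 * Real.pi) ^ n)⁻¹ *
        (smoothingConstant (EuclideanSpace ℝ (Fin n)) * ∫⁻ y, ‖f y‖ₑ ^ 2) := by
        gcongr
        exact lintegral_inverseSquareWeight_mul_chirpTransform_le hE hfm f.integrable
    _ = _ := by
        rw [hnorm]
        ring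
end

section
/- Let α ∈ ℝ with |α| < 1/2. There is a constant C = C(α) such that for every Schwartz function f on ℝ, the truncated function 𝟙_{[0,∞)} f (which lies in L²(ℝ)) satisfies ‖𝟙_{[0,∞)} f‖_{H^{α}(ℝ)} ≤ C ‖f‖_{H^{α}(ℝ)}. That is, pointwise multiplication by the sharp cutoff 𝟙_{[0,∞)} is a bounded operator on the Sobolev space H^{α}(ℝ) for every |α| < 1/2. -/
open MeasureTheory ENNReal SchwartzMap

/-- The square of the `H^s(ℝ)` norm of `v : ℝ → ℂ`, defined via the Fourier
transform `v̂(λ) = ∫ e^{-itλ} v(t) dt`. -/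
noncomputable def HnormSq (s : ℝ) (v : ℝ → ℂ) : ℝ≥0∞ :=
  ∫⁻ lam : ℝ, ENNReal.ofReal ((1 + lam ^ 2) ^ s) *
    (‖∫ t : ℝ, Complex.exp (-(Complex.I * (t : ℂ) * (lam : ℂ))) * v t‖₊ : ℝ≥0∞) ^ 2

/-- The `H^s(ℝ)` norm of `v : ℝ → ℂ`. -/
noncomputable def Hnorm (s : ℝ) (v : ℝ → ℂ) : ℝ≥0∞ :=
  (HnormSq s v) ^ ((1 : ℝ) / 2)

open FourierTransform Real

theorem continuous_fourier_of_integrable {u : ℝ → ℂ} (hu : Integrable u) : Continuous (𝓕 u) :=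
  VectorFourier.fourierIntegral_continuous Real.continuous_fourierChar
    (by exact continuous_inner) hu

theorem fourier_ae_eq_toLp_fourier {u : ℝ → ℂ} (hu : Integrable u) (hu2 : MemLp u 2) :
    𝓕 u =ᵐ[volume] (𝓕 (hu2.toLp u) : Lp (α := ℝ) ℂ 2) := by
  apply ae_eq_of_integral_contDiff_smul_eq
  · exact (continuous_fourier_of_integrable hu).locallyIntegrable
  · exact (Lp.memLp _).locallyIntegrable (by norm_num)
  intro g hg hgs
  let G : 𝓢(ℝ, ℂ) := (hgs.comp_left (g := ((↑) : ℝ → ℂ)) rfl).toSchwartzMap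
    (Complex.ofRealCLM.contDiff.comp hg)
  have hG : ∀ x, G x = (g x : ℂ) := fun x ↦ rfl
  have h1 := congrArg (fun T : 𝓢'(ℝ, ℂ) ↦ T G)
    (Lp.fourier_toTemperedDistribution_eq (hu2.toLp u))
  simp only [TemperedDistribution.fourier_apply, Lp.toTemperedDistribution_apply] at h1
  have h2 : ∫ x, (𝓕 u) x • G x = ∫ x, u x • (𝓕 (G : ℝ → ℂ)) x :=
    VectorFourier.integral_fourierIntegral_smul_eq_flip (L := innerₗ ℝ) Real.continuous_fourierChar
      (by exact continuous_inner) hu G.integrable |>.trans (by simp [flip_innerₗ]; rfl)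
  calc ∫ x, g x • 𝓕 u x = ∫ x, (𝓕 u) x • G x := by
        congr 1; ext x; rw [hG]; simp [mul_comm]
    _ = ∫ x, u x • (𝓕 (G : ℝ → ℂ)) x := h2
    _ = ∫ x, (𝓕 G) x • (hu2.toLp u) x := by
        apply integral_congr_ae
        filter_upwards [hu2.coeFn_toLp] with x hx
        rw [hx, SchwartzMap.fourier_coe, smul_eq_mul, smul_eq_mul, mul_comm]
    _ = _ := h1
    _ = _ := by congr 1

theorem lintegral_enorm_sq_fourier {u : ℝ → ℂ} (hu : Integrable u) (hu2 : MemLp u 2) :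
    ∫⁻ x, ‖𝓕 u x‖ₑ ^ 2 = ∫⁻ x, ‖u x‖ₑ ^ 2 := by
  have h : ∀ v : ℝ → ℂ, ∫⁻ x, ‖v x‖ₑ ^ 2 = eLpNorm v 2 volume ^ 2 := fun v ↦ by
    simpa using (eLpNorm_nnreal_pow_eq_lintegral (f := v) (p := 2) (μ := volume) (by simp)).symm
  rw [h, h, eLpNorm_congr_ae (fourier_ae_eq_toLp_fourier hu hu2), ← Lp.enorm_def,
    ← eLpNorm_congr_ae hu2.coeFn_toLp, ← Lp.enorm_def, ← ofReal_norm, ← ofReal_norm,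
    Lp.norm_fourier_eq]

/-- **Schur test** on `L²`, for a symmetric kernel. -/
theorem lintegral_sq_le_of_schur {K : ℝ → ℝ → ℝ≥0∞} (hK : Measurable (Function.uncurry K))
    (hsymm : ∀ x y, K x y = K y x) {p : ℝ → ℝ≥0∞} (hp : Measurable p)
    (hp0 : ∀ᵐ x, p x ≠ 0) (hpt : ∀ x, p x ≠ ⊤) {A : ℝ≥0∞}
    (hA : ∀ᵐ x, ∫⁻ y, K x y * p y ≤ A * p x) {h : ℝ → ℝ≥0∞} (hh : Measurable h) :
    ∫⁻ x, (∫⁻ y, K x y * h y) ^ 2 ≤ A ^ 2 * ∫⁻ x, h x ^ 2 := by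
  have hKx : ∀ x, Measurable (K x) := fun x ↦ hK.of_uncurry_left
  have hKm : Measurable fun z : ℝ × ℝ ↦ K z.1 z.2 := hK
  have cs : ∀ x, (∫⁻ y, K x y * h y) ^ 2
      ≤ (∫⁻ y, K x y * p y) * ∫⁻ y, K x y * (h y ^ 2 / p y) := by
    intro x
    have h1 := ENNReal.lintegral_mul_norm_pow_le (μ := volume) (f := fun y ↦ K x y * p y)
      (g := fun y ↦ K x y * (h y ^ 2 / p y)) ((hKx x).mul hp).aemeasurable
      ((hKx x).mul ((hh.pow_const 2).div hp)).aemeasurable (p := 1 / 2) (q := 1 / 2)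
      (by norm_num) (by norm_num) (by norm_num)
    have h2 : ∫⁻ y, K x y * h y = ∫⁻ y, (K x y * p y) ^ (1 / 2 : ℝ) *
        (K x y * (h y ^ 2 / p y)) ^ (1 / 2 : ℝ) := by
      apply lintegral_congr_ae
      filter_upwards [hp0] with y hy
      rw [← ENNReal.mul_rpow_of_nonneg _ _ (by norm_num),
        show K x y * p y * (K x y * (h y ^ 2 / p y)) = (K x y * h y) ^ (2 : ℝ) by
          rw [ENNReal.rpow_two]
          calc _ = K x y * K x y * (p y * (h y ^ 2 / p y)) := by ring
            _ = _ := by rw [ENNReal.mul_div_cancel hy (hpt y)]; ring,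
        ← ENNReal.rpow_mul]
      norm_num
    rw [← h2] at h1
    calc _ ≤ _ := pow_le_pow_left' h1 2
      _ = _ := by
        rw [mul_pow, ← ENNReal.rpow_two, ← ENNReal.rpow_two, ← ENNReal.rpow_mul,
          ← ENNReal.rpow_mul]
        norm_num
  calc ∫⁻ x, (∫⁻ y, K x y * h y) ^ 2
      ≤ ∫⁻ x, ∫⁻ y, A * (p x * (K x y * (h y ^ 2 / p y))) := by
        apply lintegral_mono_ae
        filter_upwards [hA] with x hx
        refine (cs x).trans ((mul_le_mul_left hx _).trans_eq ?_)
        have hm : Measurable fun y ↦ K x y * (h y ^ 2 / p y) :=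
          (hKx x).mul ((hh.pow_const 2).div hp)
        rw [mul_assoc, ← lintegral_const_mul _ hm, ← lintegral_const_mul _ (hm.const_mul _)]
    _ = ∫⁻ y, ∫⁻ x, A * (p x * (K x y * (h y ^ 2 / p y))) := by
        apply lintegral_lintegral_swap
        apply Measurable.aemeasurable
        exact ((hp.comp measurable_fst).mul (hKm.mul
          (((hh.pow_const 2).div hp).comp measurable_snd))).const_mul _
    _ = ∫⁻ y, A * (h y ^ 2 / p y) * ∫⁻ x, K y x * p x := by
        congr 1; ext y
        have hm : Measurable fun x ↦ K y x * p x := (hKx y).mul hp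
        rw [← lintegral_const_mul _ hm]
        congr 1; ext x
        rw [hsymm]; ring
    _ ≤ ∫⁻ y, A ^ 2 * h y ^ 2 := by
        apply lintegral_mono_ae
        filter_upwards [hA, hp0] with y hy hy0
        calc _ ≤ A * (h y ^ 2 / p y) * (A * p y) := by gcongr
          _ = A ^ 2 * (p y * (h y ^ 2 / p y)) := by ring
          _ = _ := by rw [ENNReal.mul_div_cancel hy0 (hpt y)]
    _ = _ := lintegral_const_mul _ (hh.pow_const 2)

theorem lintegral_comp_abs_real {g : ℝ → ℝ≥0∞} :
    ∫⁻ x, g |x| = 2 * ∫⁻ x in Set.Ioi 0, g x := by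
  have h1 : ∫⁻ x in Set.Ioi 0, g |x| = ∫⁻ x in Set.Ioi (0 : ℝ), g x :=
    setLIntegral_congr_fun measurableSet_Ioi fun x hx ↦ by simp only [abs_of_pos (Set.mem_Ioi.1 hx)]
  have h2 : ∫⁻ x in Set.Iic 0, g |x| = ∫⁻ x in Set.Ioi (0 : ℝ), g x := by
    rw [← h1, ← setLIntegral_congr (Ioi_ae_eq_Ici (a := (0 : ℝ))).symm]
    have := (Measure.measurePreserving_neg (volume : Measure ℝ)).setLIntegral_comp_preimage_emb
      (MeasurableEquiv.neg ℝ).measurableEmbedding (fun x ↦ g |x|) (Set.Iic 0)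
    simpa using this.symm
  rw [← lintegral_add_compl _ (measurableSet_Ioi (a := (0 : ℝ))), Set.compl_Ioi, h1, h2, two_mul]

/-- A symmetric kernel on `ℝ × ℝ`, homogeneous of degree `-1`. -/
noncomputable def homKernel (b x y : ℝ) : ℝ :=
  min |x| |y| ^ (-b) * max |x| |y| ^ (b - 1)

theorem homKernel_nonneg (b x y : ℝ) : 0 ≤ homKernel b x y := by
  unfold homKernel; positivity

theorem homKernel_comm (b x y : ℝ) : homKernel b x y = homKernel b y x := by
  unfold homKernel; rw [min_comm, max_comm]

theorem measurable_homKernel (b : ℝ) : Measurable fun z : ℝ × ℝ ↦ homKernel b z.1 z.2 := by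
  unfold homKernel; fun_prop

theorem lintegral_homKernel_le {b : ℝ} (hb : b < 1 / 2) {x : ℝ} (hx : x ≠ 0) :
    ∫⁻ y, ENNReal.ofReal (homKernel b x y) * ENNReal.ofReal (|y| ^ (-1 / 2 : ℝ))
      ≤ ENNReal.ofReal (4 / (1 / 2 - b)) * ENNReal.ofReal (|x| ^ (-1 / 2 : ℝ)) := by
  have ha : 0 < |x| := abs_pos.2 hx
  unfold homKernel
  set a := |x|
  rw [lintegral_comp_abs_real (g := fun y ↦
    ENNReal.ofReal (min a y ^ (-b) * max a y ^ (b - 1)) * ENNReal.ofReal (y ^ (-1 / 2 : ℝ))),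
    ← Set.Ioc_union_Ioi_eq_Ioi ha.le, lintegral_union measurableSet_Ioi
      (Set.Ioc_disjoint_Ioi le_rfl)]
  have e1 : ∫⁻ y in Set.Ioc 0 a, ENNReal.ofReal (min a y ^ (-b) * max a y ^ (b - 1)) *
      ENNReal.ofReal (y ^ (-1 / 2 : ℝ)) =
      ENNReal.ofReal (1 / (1 / 2 - b) * a ^ (-1 / 2 : ℝ)) := by
    have : ∫⁻ y in Set.Ioc 0 a, ENNReal.ofReal (min a y ^ (-b) * max a y ^ (b - 1)) *
      ENNReal.ofReal (y ^ (-1 / 2 : ℝ)) =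
      ∫⁻ y in Set.Ioc 0 a, ENNReal.ofReal (a ^ (b - 1) * y ^ (-b - 1 / 2)) := by
      refine setLIntegral_congr_fun measurableSet_Ioc fun y hy ↦ ?_
      rw [min_eq_right hy.2, max_eq_left hy.2, ← ENNReal.ofReal_mul
        (by have := hy.1.le; positivity), show -b - 1 / 2 = -b + (-1 / 2) by ring, rpow_add hy.1]
      ring_nf
    rw [this, ← ofReal_integral_eq_lintegral_ofReal, integral_const_mul,
      ← intervalIntegral.integral_of_le ha.le, integral_rpow (Or.inl (by linarith)),
      zero_rpow (by linarith)]
    · rw [sub_zero, mul_div_assoc', ← rpow_add ha]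
      ring_nf
    · exact ((intervalIntegral.intervalIntegrable_rpow' (by linarith)).1).const_mul _
    · filter_upwards [ae_restrict_mem measurableSet_Ioc] with y hy
      have := hy.1.le
      simp only [Pi.zero_apply]; positivity
  have e2 : ∫⁻ y in Set.Ioi a, ENNReal.ofReal (min a y ^ (-b) * max a y ^ (b - 1)) *
      ENNReal.ofReal (y ^ (-1 / 2 : ℝ)) =
      ENNReal.ofReal (1 / (1 / 2 - b) * a ^ (-1 / 2 : ℝ)) := by
    have : ∫⁻ y in Set.Ioi a, ENNReal.ofReal (min a y ^ (-b) * max a y ^ (b - 1)) *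
      ENNReal.ofReal (y ^ (-1 / 2 : ℝ)) =
      ∫⁻ y in Set.Ioi a, ENNReal.ofReal (a ^ (-b) * y ^ (b - 3 / 2)) := by
      refine setLIntegral_congr_fun measurableSet_Ioi fun y hy ↦ ?_
      have hy' : a < y := hy
      have hy0 : 0 < y := ha.trans hy'
      rw [min_eq_left hy'.le, max_eq_right hy'.le, ← ENNReal.ofReal_mul
        (by positivity), show b - 3 / 2 = (b - 1) + (-1 / 2) by ring, rpow_add hy0]
      ring_nf
    rw [this, ← ofReal_integral_eq_lintegral_ofReal, integral_const_mul,
      integral_Ioi_rpow_of_lt (by linarith) ha]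
    · rw [mul_div_assoc', mul_neg, ← rpow_add ha, neg_div, ← div_neg]
      ring_nf
    · exact (integrableOn_Ioi_rpow_of_lt (by linarith) ha).const_mul _
    · filter_upwards [ae_restrict_mem measurableSet_Ioi] with y hy
      have : 0 < y := ha.trans hy
      simp only [Pi.zero_apply]; positivity
  have hb' : 0 < 1 / 2 - b := by linarith
  rw [e1, e2, ← ENNReal.ofReal_add (by positivity) (by positivity),
    ← ENNReal.ofReal_mul (by positivity),
    show (2 : ℝ≥0∞) = ENNReal.ofReal 2 by simp, ← ENNReal.ofReal_mul (by norm_num)]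
  apply le_of_eq
  congr 1
  ring

theorem lintegral_sq_homKernel_le {b : ℝ} (hb : b < 1 / 2) {h : ℝ → ℝ≥0∞} (hh : Measurable h) :
    ∫⁻ x, (∫⁻ y, ENNReal.ofReal (homKernel b x y) * h y) ^ 2
      ≤ ENNReal.ofReal (4 / (1 / 2 - b)) ^ 2 * ∫⁻ x, h x ^ 2 := by
  have h0 : ∀ᵐ x : ℝ, x ≠ 0 := by simp [ae_iff]
  refine lintegral_sq_le_of_schur (K := fun x y ↦ ENNReal.ofReal (homKernel b x y)) (p := fun y ↦ ENNReal.ofReal (|y| ^ (-1 / 2 : ℝ)))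
    (measurable_homKernel b).ennreal_ofReal (fun x y ↦ by rw [homKernel_comm])
    (by fun_prop) ?_ (fun _ ↦ ENNReal.ofReal_ne_top) ?_ hh
  · filter_upwards [h0] with x hx
    have : 0 < |x| := abs_pos.2 hx
    simp only [ne_eq, ENNReal.ofReal_eq_zero, not_le]
    positivity
  · filter_upwards [h0] with x hx using lintegral_homKernel_le hb hx

theorem abs_rpow_sub_one_le {s t : ℝ} (hs : 0 < s) (hst : s ≤ t) (hst' : s⁻¹ ≤ t) (c : ℝ) :
    |s ^ c - 1| ≤ t ^ |c| - 1 := by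
  have key : ∀ d : ℝ, s ^ d ≤ t ^ |d| := by
    intro d
    rcases le_total 0 d with hd | hd
    · rw [abs_of_nonneg hd]
      exact rpow_le_rpow hs.le hst hd
    · rw [abs_of_nonpos hd]
      calc s ^ d = s⁻¹ ^ (-d) := by rw [inv_rpow hs.le, rpow_neg hs.le, inv_inv]
        _ ≤ _ := rpow_le_rpow (by positivity) hst' (by linarith)
  have h1 := key c
  have h2 := key (-c)
  rw [abs_neg, rpow_neg hs.le] at h2
  have hz : 0 < s ^ c := rpow_pos_of_pos hs c
  have h3 : 2 ≤ s ^ c + (s ^ c)⁻¹ := by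
    have : s ^ c * (s ^ c)⁻¹ = 1 := mul_inv_cancel₀ hz.ne'
    have hi : 0 < (s ^ c)⁻¹ := by positivity
    nlinarith [sq_nonneg (s ^ c - (s ^ c)⁻¹)]
  rw [abs_le]
  constructor <;> linarith

/-- The weight whose square is `(1 + λ ^ 2) ^ a` at the frequency `λ = 2 * π * ξ`. -/
noncomputable def besselWeight (a ξ : ℝ) : ℝ := (1 + (2 * π * ξ) ^ 2) ^ (a / 2)

theorem besselWeight_pos (a ξ : ℝ) : 0 < besselWeight a ξ := by
  unfold besselWeight; positivity

theorem abs_besselWeight_sub_le {a : ℝ} (ha : |a| ≤ 1) {x y : ℝ} (hx : x ≠ 0) (hy : y ≠ 0) :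
    |besselWeight a x - besselWeight a y| ≤
      |x - y| * homKernel |a| x y * besselWeight a y := by
  have hm : 0 < min |x| |y| := lt_min (abs_pos.2 hx) (abs_pos.2 hy)
  have hmM : min |x| |y| ≤ max |x| |y| := min_le_max
  have hM : 0 < max |x| |y| := hm.trans_le hmM
  have hmul : x ^ 2 ≤ max |x| |y| ^ 2 ∧ y ^ 2 ≤ max |x| |y| ^ 2 ∧
      min |x| |y| ^ 2 ≤ x ^ 2 ∧ min |x| |y| ^ 2 ≤ y ^ 2 := by
    rw [← sq_abs x, ← sq_abs y]
    refine ⟨?_, ?_, ?_, ?_⟩ <;> gcongr <;> simp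
  have hdiff : max |x| |y| - min |x| |y| ≤ |x - y| := by
    rw [max_sub_min_eq_abs']
    exact abs_abs_sub_abs_le_abs_sub x y
  unfold homKernel
  set m := min |x| |y|
  set M := max |x| |y|
  obtain ⟨h1, h2, h3, h4⟩ := hmul
  have ratio : ∀ u v : ℝ, u ^ 2 ≤ M ^ 2 → m ^ 2 ≤ v ^ 2 →
      (1 + (2 * π * u) ^ 2) / (1 + (2 * π * v) ^ 2) ≤ (M / m) ^ 2 := by
    intro u v hu hv
    rw [div_pow, div_le_div_iff₀ (by positivity) (by positivity)]
    have hp : 0 ≤ (2 * π) ^ 2 := by positivity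
    have : m ^ 2 ≤ M ^ 2 := by gcongr
    have h5 : u ^ 2 * m ^ 2 ≤ M ^ 2 * v ^ 2 := by gcongr
    nlinarith [mul_le_mul_of_nonneg_left h5 hp]
  have hsub : |besselWeight a x / besselWeight a y - 1| ≤ (M / m) ^ |a| - 1 := by
    unfold besselWeight
    rw [← div_rpow (by positivity) (by positivity)]
    refine (abs_rpow_sub_one_le (t := (M / m) ^ 2) (by positivity) (ratio x y h1 h4)
      (by rw [inv_div]; exact ratio y x h2 h3) _).trans_eq ?_
    rw [abs_div, abs_two, ← Real.rpow_natCast, ← Real.rpow_mul (by positivity)]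
    norm_num
    congr 1
    ring
  have hle : (M / m) ^ |a| - 1 ≤ |x - y| * (m ^ (-|a|) * M ^ (|a| - 1)) := by
    calc (M / m) ^ |a| - 1 ≤ (M - m) * (m ^ (-|a|) * M ^ (|a| - 1)) := by
          have e1 : (M / m) ^ |a| = M * (m ^ (-|a|) * M ^ (|a| - 1)) := by
            rw [div_rpow hM.le hm.le, rpow_sub_one hM.ne', rpow_neg hm.le]
            field_simp
          have e2 : m * (m ^ (-|a|) * M ^ (|a| - 1)) = (m / M) ^ (1 - |a|) := by
            rw [div_rpow hm.le hM.le, rpow_sub hm, Real.rpow_one, rpow_neg hm.le,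
              show |a| - 1 = -(1 - |a|) by ring, rpow_neg hM.le]
            field_simp
          have e3 : (m / M) ^ (1 - |a|) ≤ 1 :=
            rpow_le_one (by positivity) ((div_le_one hM).2 hmM) (by linarith)
          rw [sub_mul, ← e1, e2]
          linarith
      _ ≤ _ := by gcongr
  have hw := besselWeight_pos a y
  have : besselWeight a x - besselWeight a y =
      (besselWeight a x / besselWeight a y - 1) * besselWeight a y := by
    field_simp
  rw [this, abs_mul, abs_of_pos hw]
  gcongr
  exact hsub.trans hle

/-- The exponentially damped half-line cutoff. -/
noncomputable def dampedCutoff (ε : ℝ) : ℝ → ℂ :=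
  Set.indicator (Set.Ici 0) fun t ↦ Complex.exp (-ε * t)

theorem integrable_dampedCutoff {ε : ℝ} (hε : 0 < ε) : Integrable (dampedCutoff ε) := by
  rw [dampedCutoff, integrable_indicator_iff measurableSet_Ici, integrableOn_Ici_iff_integrableOn_Ioi]
  exact integrableOn_exp_mul_complex_Ioi (by simpa using hε) 0

theorem norm_dampedCutoff_le {ε : ℝ} (hε : 0 ≤ ε) (t : ℝ) : ‖dampedCutoff ε t‖ ≤ 1 := by
  unfold dampedCutoff
  by_cases ht : t ∈ Set.Ici (0 : ℝ)
  · rw [Set.indicator_of_mem ht, Complex.norm_exp]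
    have : 0 ≤ ε * t := mul_nonneg hε ht
    simpa using this
  · simp [Set.indicator_of_notMem ht]

theorem measurable_dampedCutoff (ε : ℝ) : Measurable (dampedCutoff ε) :=
  Measurable.indicator (by fun_prop) measurableSet_Ici

theorem integral_exp_mul_dampedCutoff {ε : ℝ} (hε : 0 < ε) (x : ℝ) :
    ∫ t : ℝ, Complex.exp (-(2 * π * x * Complex.I) * t) * dampedCutoff ε t =
      1 / (ε + 2 * π * x * Complex.I) := by
  have h : ∀ t : ℝ, Complex.exp (-(2 * π * x * Complex.I) * t) * dampedCutoff ε t =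
      Set.indicator (Set.Ici 0)
        (fun t : ℝ ↦ Complex.exp (-(ε + 2 * π * x * Complex.I) * t)) t := by
    intro t
    unfold dampedCutoff
    by_cases ht : t ∈ Set.Ici (0 : ℝ)
    · rw [Set.indicator_of_mem ht, Set.indicator_of_mem ht, ← Complex.exp_add]
      congr 1; ring
    · simp [Set.indicator_of_notMem ht]
  simp_rw [h]
  rw [integral_indicator measurableSet_Ici, integral_Ici_eq_integral_Ioi,
    integral_exp_mul_complex_Ioi (by simpa using hε)]
  rw [Complex.ofReal_zero, mul_zero, Complex.exp_zero, neg_div_neg_eq]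

theorem fourier_dampedCutoff_mul {ε : ℝ} (hε : 0 < ε) (H : 𝓢(ℝ, ℂ)) (x : ℝ) :
    𝓕 (fun t ↦ dampedCutoff ε t * 𝓕⁻ H t) x =
      ∫ y, H y / (ε + 2 * π * (x - y) * Complex.I) := by
  have hint : Integrable (Function.uncurry fun t y : ℝ ↦
      Complex.exp (-(2 * π * (x - y) * Complex.I) * t) * (dampedCutoff ε t * H y))
      (volume.prod volume) := by
    refine ((integrable_dampedCutoff hε).mul_prod H.integrable).bdd_mul (c := 1) ?_ ?_
    · exact Continuous.aestronglyMeasurable (by fun_prop)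
    · refine Filter.Eventually.of_forall fun z ↦ ?_
      rw [Complex.norm_exp]; simp
  calc 𝓕 (fun t ↦ dampedCutoff ε t * 𝓕⁻ H t) x
      = ∫ t : ℝ, ∫ y : ℝ, Complex.exp (-(2 * π * (x - y) * Complex.I) * t) *
          (dampedCutoff ε t * H y) := by
        rw [Real.fourier_real_eq_integral_exp_smul]
        congr 1; ext t
        rw [SchwartzMap.fourierInv_coe, Real.fourierInv_eq', ← integral_const_mul, smul_eq_mul,
          ← integral_const_mul]
        congr 1; ext y
        rw [smul_eq_mul, mul_left_comm (dampedCutoff ε t), ← mul_assoc, ← Complex.exp_add]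
        congr 2
        simp only [RCLike.inner_apply, conj_trivial]
        push_cast; ring
    _ = ∫ y : ℝ, ∫ t : ℝ, Complex.exp (-(2 * π * (x - y) * Complex.I) * t) *
          (dampedCutoff ε t * H y) := integral_integral_swap hint
    _ = _ := by
        congr 1; ext y
        have := integral_exp_mul_dampedCutoff hε (x - y)
        push_cast at this
        simp_rw [← mul_assoc]
        rw [integral_mul_const, this]
        ring

theorem integrable_div_add_mul_I {ε : ℝ} (hε : 0 < ε) {h : ℝ → ℂ} (hh : Integrable h) (x : ℝ) :
    Integrable fun y : ℝ ↦ h y / (ε + 2 * π * (x - y) * Complex.I) := by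
  simp_rw [div_eq_inv_mul]
  refine hh.bdd_mul (c := ε⁻¹) (Measurable.aestronglyMeasurable (by fun_prop)) ?_
  refine Filter.Eventually.of_forall fun y ↦ ?_
  rw [norm_inv]
  gcongr
  refine le_trans ?_ (Complex.abs_re_le_norm _)
  simp [abs_of_pos hε]

theorem abs_sub_le_norm_add_mul_I (ε x y : ℝ) :
    |x - y| ≤ ‖(ε : ℂ) + 2 * π * (x - y) * Complex.I‖ := by
  refine le_trans ?_ (Complex.abs_im_le_norm _)
  have : ((ε : ℂ) + 2 * π * (x - y) * Complex.I).im = 2 * π * (x - y) := by simp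
  rw [this, abs_mul]
  have : 1 ≤ |2 * π| := by rw [abs_of_pos (by positivity)]; linarith [pi_gt_three]
  nlinarith [abs_nonneg (x - y)]

theorem hasTemperateGrowth_besselWeight (a : ℝ) :
    (fun x ↦ (besselWeight a x : ℂ)).HasTemperateGrowth := by
  have h1 : (besselWeight a).HasTemperateGrowth := by
    have := (Function.hasTemperateGrowth_one_add_norm_sq_rpow ℝ (a / 2)).comp
      ((ContinuousLinearMap.mul ℝ ℝ (2 * π)).hasTemperateGrowth)
    convert! this using 1
    ext x
    simp [besselWeight]
  exact Complex.ofRealCLM.hasTemperateGrowth.comp h1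

theorem enorm_besselWeight_mul_fourier_le {a ε : ℝ} (ha : |a| ≤ 1) (hε : 0 < ε) (H : 𝓢(ℝ, ℂ))
    {x : ℝ} (hx : x ≠ 0) :
    ‖(besselWeight a x : ℂ) * 𝓕 (fun t ↦ dampedCutoff ε t * 𝓕⁻ H t) x‖ₑ ≤
      ‖𝓕 (fun t ↦ dampedCutoff ε t *
        𝓕⁻ (smulLeftCLM ℂ (fun x ↦ (besselWeight a x : ℂ)) H) t) x‖ₑ +
      ∫⁻ y, ENNReal.ofReal (homKernel |a| x y) * ‖(besselWeight a y : ℂ) * H y‖ₑ := by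
  rw [fourier_dampedCutoff_mul hε, fourier_dampedCutoff_mul hε, ← integral_const_mul]
  simp_rw [smulLeftCLM_apply_apply (hasTemperateGrowth_besselWeight a), smul_eq_mul]
  have i1 := (integrable_div_add_mul_I hε H.integrable x).const_mul (besselWeight a x : ℂ)
  have i2 := integrable_div_add_mul_I hε
    (smulLeftCLM ℂ (fun x ↦ (besselWeight a x : ℂ)) H).integrable x
  simp_rw [smulLeftCLM_apply_apply (hasTemperateGrowth_besselWeight a), smul_eq_mul] at i2
  rw [← sub_add_cancel (∫ y, (besselWeight a x : ℂ) * _) (∫ y, (besselWeight a y : ℂ) * H y /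
    (ε + 2 * π * (x - y) * Complex.I)), ← integral_sub i1 i2, add_comm]
  refine (enorm_add_le _ _).trans ?_
  gcongr
  refine (enorm_integral_le_lintegral_enorm _).trans (lintegral_mono_ae ?_)
  have h0 : ∀ᵐ y : ℝ, y ≠ 0 := by simp [ae_iff]
  have hxy : ∀ᵐ y : ℝ, y ≠ x := by simp [ae_iff]
  filter_upwards [h0, hxy] with y hy hyx
  rw [← ofReal_norm, ← ofReal_norm, ← ENNReal.ofReal_mul (homKernel_nonneg _ _ _)]
  apply ENNReal.ofReal_le_ofReal
  have hpos : 0 < |x - y| := abs_pos.2 (sub_ne_zero.2 hyx.symm)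
  have hD := abs_sub_le_norm_add_mul_I ε x y
  have hw := abs_besselWeight_sub_le ha hx hy
  rw [← mul_div_assoc, ← sub_div, ← sub_mul, norm_div, norm_mul, norm_mul,
    ← Complex.ofReal_sub, Complex.norm_real, Complex.norm_real, Real.norm_eq_abs,
    Real.norm_eq_abs, abs_of_pos (besselWeight_pos a y), div_le_iff₀ (hpos.trans_le hD)]
  have hk := homKernel_nonneg |a| x y
  have hwp := besselWeight_pos a y
  calc |besselWeight a x - besselWeight a y| * ‖H y‖
      ≤ |x - y| * homKernel |a| x y * besselWeight a y * ‖H y‖ := by gcongr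
    _ = homKernel |a| x y * (besselWeight a y * ‖H y‖) * |x - y| := by ring
    _ ≤ _ := by gcongr

theorem integrable_dampedCutoff_mul {ε : ℝ} (hε : 0 ≤ ε) {u : ℝ → ℂ} (hu : Integrable u) :
    Integrable fun t ↦ dampedCutoff ε t * u t :=
  hu.bdd_mul (c := 1) (measurable_dampedCutoff ε).aestronglyMeasurable
    (Filter.Eventually.of_forall (norm_dampedCutoff_le hε))

theorem lintegral_enorm_sq_fourier_dampedCutoff_le {ε : ℝ} (hε : 0 ≤ ε) (H : 𝓢(ℝ, ℂ)) :
    ∫⁻ x, ‖𝓕 (fun t ↦ dampedCutoff ε t * 𝓕⁻ H t) x‖ₑ ^ 2 ≤ ∫⁻ x, ‖H x‖ₑ ^ 2 := by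
  have hle : ∀ t, ‖dampedCutoff ε t * 𝓕⁻ H t‖ ≤ ‖𝓕⁻ H t‖ := fun t ↦ by
    rw [norm_mul]
    exact mul_le_of_le_one_left (norm_nonneg _) (norm_dampedCutoff_le hε t)
  have hi := integrable_dampedCutoff_mul hε (𝓕⁻ H).integrable
  have h2 : MemLp (fun t ↦ dampedCutoff ε t * 𝓕⁻ H t) 2 :=
    ((𝓕⁻ H).memLp 2).of_le hi.aestronglyMeasurable (Filter.Eventually.of_forall hle)
  rw [lintegral_enorm_sq_fourier hi h2]
  calc ∫⁻ t, ‖dampedCutoff ε t * 𝓕⁻ H t‖ₑ ^ 2 ≤ ∫⁻ t, ‖𝓕⁻ H t‖ₑ ^ 2 := by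
        gcongr with t
        exact enorm_le_iff_norm_le.2 (hle t)
    _ = ∫⁻ x, ‖𝓕 (𝓕⁻ H : 𝓢(ℝ, ℂ)) x‖ₑ ^ 2 :=
        (lintegral_enorm_sq_fourier (𝓕⁻ H).integrable ((𝓕⁻ H).memLp 2)).symm
    _ = _ := by rw [fourier_fourierInv_eq]

/-- The weighted estimate for the damped cutoff, uniform in the damping parameter. -/
theorem lintegral_besselWeight_fourier_dampedCutoff_le {a ε : ℝ} (ha : |a| < 1 / 2) (hε : 0 < ε)
    (f : 𝓢(ℝ, ℂ)) :
    ∫⁻ x, ‖(besselWeight a x : ℂ) * 𝓕 (fun t ↦ dampedCutoff ε t * f t) x‖ₑ ^ 2 ≤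
      2 * (1 + ENNReal.ofReal (4 / (1 / 2 - |a|)) ^ 2) *
        ∫⁻ x, ‖(besselWeight a x : ℂ) * 𝓕 f x‖ₑ ^ 2 := by
  set G : 𝓢(ℝ, ℂ) := smulLeftCLM ℂ (fun x ↦ (besselWeight a x : ℂ)) (𝓕 f) with hG
  have hGx : ∀ x, G x = (besselWeight a x : ℂ) * 𝓕 f x := fun x ↦
    smulLeftCLM_apply_apply (hasTemperateGrowth_besselWeight a) _ _
  have h0 : ∀ᵐ x : ℝ, x ≠ 0 := by simp [ae_iff]
  have hGm : Measurable fun x ↦ ‖G x‖ₑ := G.continuous.measurable.enorm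
  have hFm : Measurable fun x ↦ ‖𝓕 (fun t ↦ dampedCutoff ε t * 𝓕⁻ G t) x‖ₑ :=
    (continuous_fourier_of_integrable
      (integrable_dampedCutoff_mul hε.le (𝓕⁻ G).integrable)).measurable.enorm
  calc ∫⁻ x, ‖(besselWeight a x : ℂ) * 𝓕 (fun t ↦ dampedCutoff ε t * f t) x‖ₑ ^ 2
      ≤ ∫⁻ x, 2 * (‖𝓕 (fun t ↦ dampedCutoff ε t * 𝓕⁻ G t) x‖ₑ ^ 2 +
          (∫⁻ y, ENNReal.ofReal (homKernel |a| x y) * ‖G y‖ₑ) ^ 2) := by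
        apply lintegral_mono_ae
        filter_upwards [h0] with x hx
        have h1 := enorm_besselWeight_mul_fourier_le (by linarith) hε (𝓕 f) hx
        rw [fourierInv_fourier_eq, ← hG] at h1
        simp_rw [← hGx] at h1
        refine (pow_le_pow_left' h1 2).trans ?_
        have := ENNReal.rpow_add_le_mul_rpow_add_rpow
          ‖𝓕 (fun t ↦ dampedCutoff ε t * 𝓕⁻ G t) x‖ₑ
          (∫⁻ y, ENNReal.ofReal (homKernel |a| x y) * ‖G y‖ₑ) one_le_two
        norm_num at this
        exact this
    _ = 2 * ((∫⁻ x, ‖𝓕 (fun t ↦ dampedCutoff ε t * 𝓕⁻ G t) x‖ₑ ^ 2) +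
          ∫⁻ x, (∫⁻ y, ENNReal.ofReal (homKernel |a| x y) * ‖G y‖ₑ) ^ 2) := by
        rw [lintegral_const_mul' _ _ (by simp), lintegral_add_left (hFm.pow_const 2)]
    _ ≤ 2 * ((∫⁻ x, ‖G x‖ₑ ^ 2) +
          ENNReal.ofReal (4 / (1 / 2 - |a|)) ^ 2 * ∫⁻ x, ‖G x‖ₑ ^ 2) := by
        exact mul_le_mul_right (add_le_add (lintegral_enorm_sq_fourier_dampedCutoff_le hε.le G)
          (lintegral_sq_homKernel_le ha hGm)) 2
    _ = _ := by
        simp_rw [hGx]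
        ring

theorem tendsto_fourier_dampedCutoff_mul {f : ℝ → ℂ} (hf : Integrable f) (x : ℝ) :
    Filter.Tendsto (fun n : ℕ ↦ 𝓕 (fun t ↦ dampedCutoff (1 / ((n : ℝ) + 1)) t * f t) x)
      Filter.atTop (nhds (𝓕 (Set.indicator (Set.Ici 0) f) x)) := by
  simp_rw [Real.fourier_real_eq_integral_exp_smul, smul_eq_mul]
  refine tendsto_integral_of_dominated_convergence (fun t ↦ ‖f t‖) (fun n ↦ ?_) hf.norm
    (fun n ↦ ?_) ?_
  · exact (Continuous.aestronglyMeasurable (by fun_prop)).mul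
      ((measurable_dampedCutoff _).aestronglyMeasurable.mul hf.aestronglyMeasurable)
  · refine Filter.Eventually.of_forall fun t ↦ ?_
    rw [norm_mul, Complex.norm_exp_ofReal_mul_I, one_mul, norm_mul]
    exact mul_le_of_le_one_left (norm_nonneg _) (norm_dampedCutoff_le (by positivity) t)
  · refine Filter.Eventually.of_forall fun t ↦ Filter.Tendsto.const_mul _ ?_
    unfold dampedCutoff
    by_cases ht : t ∈ Set.Ici (0 : ℝ)
    · simp only [Set.indicator_of_mem ht]
      have h1 : Filter.Tendsto (fun n : ℕ ↦ ((1 / ((n : ℝ) + 1) : ℝ) : ℂ)) Filter.atTop (nhds 0) :=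
        (Complex.continuous_ofReal.tendsto' 0 0 rfl).comp tendsto_one_div_add_atTop_nhds_zero_nat
      have h2 : Continuous fun z : ℂ ↦ Complex.exp (-z * t) * f t := by fun_prop
      exact (h2.tendsto' 0 (f t) (by simp)).comp h1
    · simp [Set.indicator_of_notMem ht]

theorem lintegral_besselWeight_fourier_indicator_le {a : ℝ} (ha : |a| < 1 / 2) (f : 𝓢(ℝ, ℂ)) :
    ∫⁻ x, ‖(besselWeight a x : ℂ) * 𝓕 (Set.indicator (Set.Ici 0) f) x‖ₑ ^ 2 ≤
      2 * (1 + ENNReal.ofReal (4 / (1 / 2 - |a|)) ^ 2) *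
        ∫⁻ x, ‖(besselWeight a x : ℂ) * 𝓕 f x‖ₑ ^ 2 := by
  have hpos : ∀ n : ℕ, 0 < 1 / ((n : ℝ) + 1) := fun n ↦ by positivity
  have hlim : ∀ x, ‖(besselWeight a x : ℂ) * 𝓕 (Set.indicator (Set.Ici 0) f) x‖ₑ ^ 2 =
      Filter.liminf (fun n : ℕ ↦ ‖(besselWeight a x : ℂ) *
        𝓕 (fun t ↦ dampedCutoff (1 / ((n : ℝ) + 1)) t * f t) x‖ₑ ^ 2) Filter.atTop := fun x ↦
    (((ENNReal.continuous_pow 2).tendsto _).comp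
      ((tendsto_fourier_dampedCutoff_mul f.integrable x).const_mul _).enorm).liminf_eq.symm
  have hcont : Continuous (fun x ↦ (besselWeight a x : ℂ)) :=
    (hasTemperateGrowth_besselWeight a).1.continuous
  simp_rw [hlim]
  refine (lintegral_liminf_le fun n ↦ ?_).trans ?_
  · exact (hcont.mul (continuous_fourier_of_integrable
      (integrable_dampedCutoff_mul (hpos n).le f.integrable))).measurable.enorm.pow_const 2
  · exact Filter.liminf_le_of_frequently_le' (Filter.Frequently.of_forall fun n ↦
      lintegral_besselWeight_fourier_dampedCutoff_le ha (hpos n) f)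

theorem HnormSq_eq_lintegral_fourier (a : ℝ) (v : ℝ → ℂ) :
    HnormSq a v =
      ENNReal.ofReal (2 * π) * ∫⁻ x, ‖(besselWeight a x : ℂ) * 𝓕 v x‖ₑ ^ 2 := by
  have h2π : (2 * π) ≠ 0 := by positivity
  have hcomp : ∀ g : ℝ → ℝ≥0∞, ∫⁻ x, g x = ENNReal.ofReal (2 * π) * ∫⁻ x, g (2 * π * x) := by
    intro g
    conv_lhs => rw [← Real.smul_map_volume_mul_left h2π]
    rw [lintegral_smul_measure, abs_of_pos (by positivity), smul_eq_mul]
    congr 1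
    exact lintegral_map_equiv g (Homeomorph.mulLeft₀ (2 * π) h2π).toMeasurableEquiv
  rw [HnormSq, hcomp]
  congr 2; ext x
  have hw : ENNReal.ofReal ((1 + (2 * π * x) ^ 2) ^ a) = ‖(besselWeight a x : ℂ)‖ₑ ^ 2 := by
    rw [← ofReal_norm, Complex.norm_real, Real.norm_of_nonneg (besselWeight_pos a x).le,
      ← ENNReal.ofReal_pow (besselWeight_pos a x).le, besselWeight,
      ← Real.rpow_mul_natCast (by positivity)]
    norm_num
  rw [hw, enorm_mul, mul_pow, Real.fourier_real_eq_integral_exp_smul]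
  congr 3
  apply congrArg
  congr 1; ext t
  rw [smul_eq_mul]
  congr 2
  push_cast; ring

/-- The sharp cutoff `𝟙_{[0,∞)}` is a bounded multiplier on `H^α(ℝ)`
whenever `|α| < 1/2`. -/
theorem sharp_cutoff_bounded_on_Hs (α : ℝ) (hα : |α| < 1 / 2) :
    ∃ C : ℝ≥0∞, C ≠ ⊤ ∧
      ∀ f : 𝓢(ℝ, ℂ),
        Hnorm α (Set.indicator (Set.Ici (0 : ℝ)) (⇑f)) ≤ C * Hnorm α (⇑f) := by
  refine ⟨(2 * (1 + ENNReal.ofReal (4 / (1 / 2 - |α|)) ^ 2)) ^ ((1 : ℝ) / 2),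
    ENNReal.rpow_ne_top_of_nonneg (by norm_num) (by finiteness), fun f ↦ ?_⟩
  rw [Hnorm, Hnorm, ← ENNReal.mul_rpow_of_nonneg _ _ (by norm_num),
    HnormSq_eq_lintegral_fourier, HnormSq_eq_lintegral_fourier, mul_left_comm]
  gcongr
  exact lintegral_besselWeight_fourier_indicator_le hα f
end

section
/- Let n ≥ 3. There is a constant C = C(n) such that for every measurable w : ℝ^n → ℂ with |w(x)| ≤ ⟨x⟩^{-1} for all x, and every Schwartz function g on ℝ × ℝ^n, the Bochner integral ∫_ℝ e^{-isΔ}( w · g(s,·) ) ds (which converges absolutely in L²(ℝ^n) since ∫ ‖g(s,·)‖_{L²} ds < ∞) satisfies ‖ ∫_ℝ e^{-isΔ}( w · g(s,·) ) ds ‖_{L²(ℝ^n)} ≤ C ‖g‖_{L²(ℝ×ℝ^n)}. -/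
open MeasureTheory ENNReal SchwartzMap

open scoped FourierTransform InnerProductSpace

section Duality

variable {V : Type*} [NormedAddCommGroup V] [InnerProductSpace ℝ V] [FiniteDimensional ℝ V]
  [MeasurableSpace V] [BorelSpace V]

theorem eLpNorm_two_le_of_forall_schwartz {u : V → ℂ} (hu : LocallyIntegrable u volume)
    (hmul : ∀ f : 𝓢(V, ℂ), Integrable (fun x => f x * u x) volume) {M : ℝ} (hM : 0 ≤ M)
    (hb : ∀ f : 𝓢(V, ℂ), ‖∫ x, f x * u x‖ ≤ M * ‖f.toLp 2 volume‖) :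
    eLpNorm u 2 volume ≤ ENNReal.ofReal M := by
  let T : 𝓢(V, ℂ) →ₗ[ℂ] ℂ :=
    { toFun := fun f => ∫ x, f x * u x
      map_add' := fun f g => by
        simp only [_root_.add_apply, add_mul]
        exact integral_add (hmul f) (hmul g)
      map_smul' := fun c f => by
        simp only [_root_.smul_apply, smul_eq_mul, mul_assoc, RingHom.id_apply]
        exact integral_const_mul c _ }
  let e : 𝓢(V, ℂ) →ₗ[ℂ] Lp ℂ 2 (volume : Measure V) :=
    (SchwartzMap.toLpCLM ℂ ℂ 2 (volume : Measure V)).toLinearMap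
  have hdense : DenseRange e := SchwartzMap.denseRange_toLpCLM ENNReal.ofNat_ne_top
  have hTe : ∀ f, ‖T f‖ ≤ M * ‖e f‖ := hb
  let S := T.extendOfNorm e
  have hS : ‖S‖ ≤ M := LinearMap.opNorm_extendOfNorm_le hdense hM hTe
  let v : Lp ℂ 2 (volume : Measure V) := (InnerProductSpace.toDual ℂ _).symm S
  have hv : ‖v‖ ≤ M := by simpa [v] using hS
  have hvS : ∀ f : 𝓢(V, ℂ), ∫ x, f x * (starRingEnd ℂ) (v x) = ∫ x, f x * u x := by
    intro f
    have h1 : ⟪v, f.toLp 2 volume⟫_ℂ = S (e f) := InnerProductSpace.toDual_symm_apply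
    rw [LinearMap.extendOfNorm_eq hdense ⟨M, hTe⟩, L2.inner_def] at h1
    change _ = ∫ x, f x * u x at h1
    rw [← h1]
    refine integral_congr_ae ?_
    filter_upwards [f.coeFn_toLp 2 volume] with x hx
    simp [hx, RCLike.inner_apply]
  have hvL : MemLp (fun x => (starRingEnd ℂ) (v x)) 2 (volume : Measure V) := (Lp.memLp v).star
  have hae : ∀ᵐ x, u x = (starRingEnd ℂ) (v x) := by
    refine ae_eq_of_integral_contDiff_smul_eq hu (hvL.locallyIntegrable one_le_two) ?_
    intro g hg hgc
    have h1 : HasCompactSupport (fun x => (g x : ℂ)) := hgc.comp_left (g := Complex.ofReal) rfl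
    have h2 : ContDiff ℝ ((⊤ : ℕ∞) : WithTop ℕ∞) (fun x => (g x : ℂ)) :=
      Complex.ofRealCLM.contDiff.comp hg
    have := hvS (h1.toSchwartzMap h2)
    simpa [Complex.real_smul] using this.symm
  rw [eLpNorm_congr_ae hae]
  have : eLpNorm (fun x => (starRingEnd ℂ) (v x)) 2 volume = eLpNorm v 2 volume :=
    eLpNorm_congr_norm_ae (by simp)
  rw [this, ← ENNReal.ofReal_toReal (Lp.eLpNorm_ne_top v), ← Lp.norm_def]
  exact ENNReal.ofReal_le_ofReal hv

theorem norm_integral_mul_le_of_memLp {f u : V → ℂ} (hf : MemLp f 2 volume)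
    (hu : MemLp u 2 volume) :
    ‖∫ x, f x * u x‖ ≤ (eLpNorm u 2 volume).toReal * (eLpNorm f 2 volume).toReal := by
  have h : eLpNorm (f • u) 1 volume ≤ eLpNorm f 2 volume * eLpNorm u 2 volume :=
    eLpNorm_smul_le_mul_eLpNorm (p := 2) (q := 2) (r := 1) hu.1 hf.1
  rw [mul_comm, ← ENNReal.toReal_mul]
  have h2 := enorm_integral_le_lintegral_enorm (μ := volume) (fun x => f x * u x)
  rw [← eLpNorm_one_eq_lintegral_enorm] at h2
  change _ ≤ eLpNorm (f • u) 1 volume at h2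
  have h3 := ENNReal.toReal_mono (ENNReal.mul_ne_top hf.eLpNorm_ne_top hu.eLpNorm_ne_top)
    (h2.trans h)
  simpa using h3

theorem integral_mul_fourier_eq {h : V → ℂ} (hh : Integrable h volume) (f : 𝓢(V, ℂ)) :
    ∫ ξ, f ξ * 𝓕 h ξ = ∫ x, 𝓕 f x * h x := by
  have := VectorFourier.integral_fourierIntegral_smul_eq_flip (L := innerₗ V) (μ := volume)
    (ν := volume) Real.continuous_fourierChar continuous_inner f.integrable hh
  rw [flip_innerₗ] at this
  exact this.symm

theorem fourier_norm_le {h : V → ℂ} (ξ : V) : ‖𝓕 h ξ‖ ≤ ∫ x, ‖h x‖ :=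
  VectorFourier.norm_fourierIntegral_le_integral_norm _ _ _ _ _

theorem continuous_fourier {h : V → ℂ} (hh : Integrable h volume) : Continuous (𝓕 h) :=
  VectorFourier.fourierIntegral_continuous Real.continuous_fourierChar continuous_inner hh

theorem integrable_schwartz_mul {u : V → ℂ} (hu : AEStronglyMeasurable u volume) {B : ℝ}
    (hB : ∀ x, ‖u x‖ ≤ B) (f : 𝓢(V, ℂ)) : Integrable (fun x => f x * u x) volume :=
  f.integrable.mul_bdd hu (Filter.Eventually.of_forall hB)

theorem locallyIntegrable_of_bounded {u : V → ℂ} (hu : AEStronglyMeasurable u volume) {B : ℝ}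
    (hB : ∀ x, ‖u x‖ ≤ B) : LocallyIntegrable u volume := by
  have : MemLp u ∞ volume := memLp_top_of_bound hu B (Filter.Eventually.of_forall hB)
  exact this.locallyIntegrable le_top

theorem eLpNorm_fourier_le {h : V → ℂ} (h1 : Integrable h volume) (h2 : MemLp h 2 volume) :
    eLpNorm (𝓕 h) 2 volume ≤ eLpNorm h 2 volume := by
  rw [← ENNReal.ofReal_toReal h2.eLpNorm_ne_top]
  have hm := (continuous_fourier h1).aestronglyMeasurable (μ := volume)
  refine eLpNorm_two_le_of_forall_schwartz (locallyIntegrable_of_bounded hm fourier_norm_le)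
    (integrable_schwartz_mul hm fourier_norm_le) ENNReal.toReal_nonneg ?_
  intro f
  rw [integral_mul_fourier_eq h1, ← SchwartzMap.norm_fourier_toL2_eq, SchwartzMap.norm_toLp,
    SchwartzMap.fourier_coe]
  refine norm_integral_mul_le_of_memLp ?_ h2
  rw [← SchwartzMap.fourier_coe]
  exact (𝓕 f).memLp 2 volume

end Duality

section GaussianKernel

variable {V : Type*} [NormedAddCommGroup V] [InnerProductSpace ℝ V] [FiniteDimensional ℝ V]
  [MeasurableSpace V] [BorelSpace V]

theorem integral_gaussian_mul_fourier {b : ℂ} (hb : 0 < b.re) (φ : 𝓢(V, ℂ)) (y : V) :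
    ∫ z, Complex.exp (-b * ‖y - z‖ ^ 2) * 𝓕 φ z =
      (Real.pi / b) ^ (Module.finrank ℝ V / 2 : ℂ) *
        ∫ ξ, Complex.exp (-Real.pi ^ 2 * ‖ξ‖ ^ 2 / b) * (𝐞 (-⟪ξ, y⟫_ℝ) • φ ξ) := by
  have hG : Integrable (fun v : V => Complex.exp (-b * ‖v‖ ^ 2)) volume := by
    simpa using GaussianFourier.integrable_cexp_neg_mul_sq_norm_add hb 0 (0 : V)
  have hG' := hG.comp_add_right (-y)
  have h := integral_mul_fourier_eq hG' φ
  have h2 : ∀ ξ, 𝓕 (fun v : V => Complex.exp (-b * ‖v + -y‖ ^ 2)) ξ =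
      𝐞 (-⟪ξ, y⟫_ℝ) • 𝓕 (fun v : V => Complex.exp (-b * ‖v‖ ^ 2)) ξ := by
    intro ξ
    have := congrFun (VectorFourier.fourierIntegral_comp_add_right 𝐞 (volume : Measure V)
      (innerₗ V) (fun v : V => Complex.exp (-b * ‖v‖ ^ 2)) (-y)) ξ
    rw [innerₗ_apply_apply, inner_neg_left, real_inner_comm] at this
    exact this
  simp only [h2, fourier_gaussian_innerProductSpace hb] at h
  rw [← integral_const_mul]
  convert! h.symm using 1
  · refine integral_congr_ae (Filter.Eventually.of_forall fun z => ?_)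
    simp only [mul_comm, ← sub_eq_add_neg, norm_sub_rev, SchwartzMap.fourier_coe]
  · refine integral_congr_ae (Filter.Eventually.of_forall fun ξ => ?_)
    simp only [Circle.smul_def, smul_eq_mul]
    ring

theorem integral_cexp_mul_fourier {b : ℂ} (hb : 0 ≤ b.re) (hb0 : b ≠ 0) (φ : 𝓢(V, ℂ)) (y : V) :
    ∫ z, Complex.exp (-b * ‖y - z‖ ^ 2) * 𝓕 φ z =
      (Real.pi / b) ^ (Module.finrank ℝ V / 2 : ℂ) *
        ∫ ξ, Complex.exp (-Real.pi ^ 2 * ‖ξ‖ ^ 2 / b) * (𝐞 (-⟪ξ, y⟫_ℝ) • φ ξ) := by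
  have hlim : Filter.Tendsto (fun ε : ℝ => b + (ε : ℂ)) (nhdsWithin 0 (Set.Ioi 0)) (nhds b) := by
    have : Continuous (fun ε : ℝ => b + (ε : ℂ)) := by fun_prop
    simpa using (this.tendsto 0).mono_left nhdsWithin_le_nhds
  have hinv := hlim.inv₀ hb0
  have hre : ∀ ε : ℝ, 0 < ε → 0 < (b + (ε : ℂ)).re := fun ε hε => by simp; linarith
  have hslit : (Real.pi : ℂ) / b ∈ Complex.slitPlane := by
    have h0 : (Real.pi : ℂ) / b ≠ 0 := div_ne_zero (by exact_mod_cast Real.pi_ne_zero) hb0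
    rw [Complex.mem_slitPlane_iff_not_le_zero]
    intro hle
    have h1 : 0 ≤ ((Real.pi : ℂ) / b).re := by
      rw [div_eq_mul_inv, Complex.re_ofReal_mul, Complex.inv_re]
      have := Real.pi_pos
      have := Complex.normSq_nonneg b
      positivity
    rw [Complex.le_def] at hle
    exact h0 (Complex.ext (le_antisymm hle.1 h1) hle.2)
  have hL : Filter.Tendsto (fun ε : ℝ => ∫ z, Complex.exp (-(b + (ε : ℂ)) * ‖y - z‖ ^ 2) * 𝓕 φ z)
      (nhdsWithin 0 (Set.Ioi 0)) (nhds (∫ z, Complex.exp (-b * ‖y - z‖ ^ 2) * 𝓕 φ z)) := by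
    refine tendsto_integral_filter_of_dominated_convergence (fun z => ‖𝓕 φ z‖) ?_ ?_ ?_ ?_
    · exact Filter.Eventually.of_forall fun ε =>
        (Continuous.mul (by fun_prop) (𝓕 φ).continuous).aestronglyMeasurable
    · filter_upwards [self_mem_nhdsWithin] with ε hε
      refine Filter.Eventually.of_forall fun z => ?_
      rw [norm_mul, Complex.norm_exp]
      refine mul_le_of_le_one_left (norm_nonneg _) (Real.exp_le_one_iff.2 ?_)
      rw [← Complex.ofReal_pow, Complex.re_mul_ofReal, Complex.neg_re]
      have := hre ε hε
      nlinarith [sq_nonneg ‖y - z‖]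
    · exact (𝓕 φ).integrable.norm
    · refine Filter.Eventually.of_forall fun z => ?_
      exact ((Complex.continuous_exp.tendsto _).comp (hlim.neg.mul_const _)).mul_const _
  have hR : Filter.Tendsto (fun ε : ℝ => ((Real.pi : ℂ) / (b + (ε : ℂ))) ^
        (Module.finrank ℝ V / 2 : ℂ) * ∫ ξ, Complex.exp (-Real.pi ^ 2 * ‖ξ‖ ^ 2 / (b + (ε : ℂ))) *
          (𝐞 (-⟪ξ, y⟫_ℝ) • φ ξ)) (nhdsWithin 0 (Set.Ioi 0))
      (nhds (((Real.pi : ℂ) / b) ^ (Module.finrank ℝ V / 2 : ℂ) *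
        ∫ ξ, Complex.exp (-Real.pi ^ 2 * ‖ξ‖ ^ 2 / b) * (𝐞 (-⟪ξ, y⟫_ℝ) • φ ξ))) := by
    refine Filter.Tendsto.mul ?_ ?_
    · exact (continuousAt_cpow_const hslit).tendsto.comp (tendsto_const_nhds.div hlim hb0)
    refine tendsto_integral_filter_of_dominated_convergence (fun z => ‖φ z‖) ?_ ?_ ?_ ?_
    · refine Filter.Eventually.of_forall fun ε => Continuous.aestronglyMeasurable ?_
      exact Continuous.mul (by fun_prop)
        ((Real.continuous_fourierChar.comp (by fun_prop)).smul φ.continuous)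
    · filter_upwards [self_mem_nhdsWithin] with ε hε
      refine Filter.Eventually.of_forall fun z => ?_
      rw [norm_mul, Complex.norm_exp, Circle.norm_smul]
      refine mul_le_of_le_one_left (norm_nonneg _) (Real.exp_le_one_iff.2 ?_)
      have h1 : -(Real.pi : ℂ) ^ 2 * (‖z‖ : ℂ) ^ 2 / (b + (ε : ℂ)) =
        ((-(Real.pi ^ 2 * ‖z‖ ^ 2) : ℝ) : ℂ) * (b + (ε : ℂ))⁻¹ := by push_cast; ring
      rw [h1, Complex.re_ofReal_mul, Complex.inv_re]
      have h2 := hre ε hε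
      have h3 : 0 ≤ (b + (ε : ℂ)).re / Complex.normSq (b + (ε : ℂ)) :=
        div_nonneg h2.le (Complex.normSq_nonneg _)
      have h4 : 0 ≤ Real.pi ^ 2 * ‖z‖ ^ 2 := by positivity
      nlinarith
    · exact φ.integrable.norm
    · refine Filter.Eventually.of_forall fun z => ?_
      exact ((Complex.continuous_exp.tendsto _).comp (tendsto_const_nhds.div hlim hb0)).mul_const _
  refine tendsto_nhds_unique hL (hR.congr' ?_)
  filter_upwards [self_mem_nhdsWithin] with ε hε
  exact (integral_gaussian_mul_fourier (hre ε hε) φ y).symm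

end GaussianKernel

section SchrodFourier

variable {n : ℕ}

theorem schrod_fourier {t : ℝ} (ht : t ≠ 0) (φ : 𝓢(EuclideanSpace ℝ (Fin n), ℂ))
    (y : EuclideanSpace ℝ (Fin n)) :
    schrod n t ⇑(𝓕 φ : 𝓢(EuclideanSpace ℝ (Fin n), ℂ)) y =
      𝓕 (fun ξ => Complex.exp (((-(4 * Real.pi ^ 2 * t * ‖ξ‖ ^ 2) : ℝ) : ℂ) * Complex.I) * φ ξ) y := by
  have htc : (t : ℂ) ≠ 0 := by exact_mod_cast ht
  have hpi : (Real.pi : ℂ) ≠ 0 := by exact_mod_cast Real.pi_ne_zero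
  have hb : -Complex.I / (4 * (t : ℂ)) = ((-(1 / (4 * t)) : ℝ) : ℂ) * Complex.I := by
    push_cast; field_simp
  have hb0 : -Complex.I / (4 * (t : ℂ)) ≠ 0 := by simp [htc]
  have key := integral_cexp_mul_fourier (b := -Complex.I / (4 * (t : ℂ)))
    (by rw [hb, Complex.re_ofReal_mul]; simp) hb0 φ y
  have hpb : (Real.pi : ℂ) / (-Complex.I / (4 * (t : ℂ))) = 4 * Real.pi * Complex.I * (t : ℂ) := by
    field_simp
    simp
  rw [hpb, finrank_euclideanSpace_fin] at key
  rw [schrod, if_neg ht]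
  have h1 : ∫ z, Complex.exp (Complex.I * (‖y - z‖ : ℂ) ^ 2 / (4 * (t : ℂ))) * 𝓕 φ z =
      ∫ z, Complex.exp (-(-Complex.I / (4 * (t : ℂ))) * ‖y - z‖ ^ 2) * 𝓕 φ z := by
    refine integral_congr_ae (Filter.Eventually.of_forall fun z => ?_)
    dsimp only
    congr 2
    ring
  rw [h1, key, ← mul_assoc, neg_div, Complex.cpow_neg, inv_mul_cancel₀, one_mul, Real.fourier_eq]
  · refine integral_congr_ae (Filter.Eventually.of_forall fun ξ => ?_)
    simp only [Circle.smul_def, smul_eq_mul]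
    have : -(Real.pi : ℂ) ^ 2 * (‖ξ‖ : ℂ) ^ 2 / (-Complex.I / (4 * (t : ℂ))) =
        ((-(4 * Real.pi ^ 2 * t * ‖ξ‖ ^ 2) : ℝ) : ℂ) * Complex.I := by
      rw [div_eq_iff hb0]
      push_cast
      field_simp
      rw [Complex.I_sq]
      ring
    rw [this]
    ring
  · simp [Complex.cpow_eq_zero_iff, htc, hpi]

theorem integral_fourier_mul_schrod {t : ℝ} (ht : t ≠ 0) (φ : 𝓢(EuclideanSpace ℝ (Fin n), ℂ))
    {h : EuclideanSpace ℝ (Fin n) → ℂ} (hh : Integrable h volume) :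
    ∫ x, 𝓕 φ x * schrod n t h x =
      ∫ ξ, Complex.exp (((-(4 * Real.pi ^ 2 * t * ‖ξ‖ ^ 2) : ℝ) : ℂ) * Complex.I) * φ ξ * 𝓕 h ξ := by
  have hφm : Integrable (fun ξ : EuclideanSpace ℝ (Fin n) =>
      Complex.exp (((-(4 * Real.pi ^ 2 * t * ‖ξ‖ ^ 2) : ℝ) : ℂ) * Complex.I) * φ ξ) volume := by
    refine φ.integrable.bdd_mul (c := 1) (Continuous.aestronglyMeasurable (by fun_prop)) ?_
    exact Filter.Eventually.of_forall fun ξ => (Complex.norm_exp_ofReal_mul_I _).le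
  have flip := VectorFourier.integral_fourierIntegral_smul_eq_flip
    (L := innerₗ (EuclideanSpace ℝ (Fin n))) (μ := volume)
    (ν := volume) Real.continuous_fourierChar continuous_inner hφm hh
  rw [flip_innerₗ] at flip
  refine Eq.trans ?_ flip
  simp only [smul_eq_mul]
  have hs : ∀ y, VectorFourier.fourierIntegral 𝐞 volume (innerₗ (EuclideanSpace ℝ (Fin n)))
      (fun ξ : EuclideanSpace ℝ (Fin n) =>
      Complex.exp (((-(4 * Real.pi ^ 2 * t * ‖ξ‖ ^ 2) : ℝ) : ℂ) * Complex.I) * φ ξ) y =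
      schrod n t ⇑(𝓕 φ : 𝓢(EuclideanSpace ℝ (Fin n), ℂ)) y := fun y => (schrod_fourier ht φ y).symm
  simp only [hs, schrod, if_neg ht]
  have hmul : Integrable (Function.uncurry fun x y : EuclideanSpace ℝ (Fin n) =>
      Complex.exp (Complex.I * (‖x - y‖ : ℂ) ^ 2 / (4 * (t : ℂ))) * (𝓕 φ x * h y))
      (volume.prod volume) := by
    refine ((𝓕 φ).integrable.mul_prod hh).bdd_mul (c := 1)
      (Continuous.aestronglyMeasurable (by fun_prop)) ?_
    refine Filter.Eventually.of_forall fun z => ?_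
    have : Complex.I * (‖z.1 - z.2‖ : ℂ) ^ 2 / (4 * (t : ℂ)) =
      ((‖z.1 - z.2‖ ^ 2 / (4 * t) : ℝ) : ℂ) * Complex.I := by push_cast; ring
    rw [this, Complex.norm_exp_ofReal_mul_I]
  have hsw := integral_integral_swap hmul
  set c := (4 * Real.pi * Complex.I * (t : ℂ)) ^ (-(n : ℂ) / 2)
  have e1 : ∀ x, 𝓕 φ x * (c * ∫ y, Complex.exp (Complex.I * (‖x - y‖ : ℂ) ^ 2 / (4 * (t : ℂ))) *
      h y) = c * ∫ y, Complex.exp (Complex.I * (‖x - y‖ : ℂ) ^ 2 / (4 * (t : ℂ))) *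
        (𝓕 φ x * h y) := by
    intro x
    rw [mul_left_comm, ← integral_const_mul]
    congr 2; ext y; ring
  have e2 : ∀ y, (c * ∫ x, Complex.exp (Complex.I * (‖y - x‖ : ℂ) ^ 2 / (4 * (t : ℂ))) *
      𝓕 φ x) * h y = c * ∫ x, Complex.exp (Complex.I * (‖x - y‖ : ℂ) ^ 2 / (4 * (t : ℂ))) *
        (𝓕 φ x * h y) := by
    intro y
    rw [mul_assoc, ← integral_mul_const]
    congr 2; ext x; rw [norm_sub_rev]; ring
  simp only [e1, e2, integral_const_mul, hsw]

theorem lintegral_Ioi_one_inv_sq :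
    ∫⁻ r in Set.Ioi (1 : ℝ), ENNReal.ofReal (r⁻¹) ^ 2 = 1 := by
  have h1 : ∫⁻ r in Set.Ioi (1 : ℝ), ENNReal.ofReal (r⁻¹) ^ 2 =
      ∫⁻ r in Set.Ioi (1 : ℝ), ENNReal.ofReal (r ^ (-2 : ℝ)) := by
    refine setLIntegral_congr_fun measurableSet_Ioi fun r hr => ?_
    have hr0 : (0 : ℝ) < r := zero_lt_one.trans hr
    rw [← ENNReal.ofReal_pow (by positivity), Real.rpow_neg hr0.le]
    simp
  rw [h1, ← ofReal_integral_eq_lintegral_ofReal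
    (integrableOn_Ioi_rpow_of_lt (by norm_num) zero_lt_one), integral_Ioi_rpow_of_lt (by norm_num)
    zero_lt_one]
  · norm_num
  · filter_upwards [self_mem_ae_restrict measurableSet_Ioi] with r hr
    have hr0 : (0 : ℝ) < r := zero_lt_one.trans hr
    positivity

theorem sq_enorm_le_lintegral_deriv {ψ : ℝ → ℂ} (hψ : ContDiff ℝ 1 ψ)
    (hlim : Filter.Tendsto ψ Filter.atTop (nhds 0)) :
    ‖ψ 1‖ₑ ^ 2 ≤ ∫⁻ r in Set.Ioi (1 : ℝ), ENNReal.ofReal r ^ 2 * ‖deriv ψ r‖ₑ ^ 2 := by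
  have h1 : ‖ψ 1‖ₑ ≤ ∫⁻ r in Set.Ioi (1 : ℝ), ‖deriv ψ r‖ₑ := by
    have ht : Filter.Tendsto (fun R => ‖ψ R - ψ 1‖ₑ) Filter.atTop (nhds ‖(0 : ℂ) - ψ 1‖ₑ) :=
      (hlim.sub_const _).enorm
    rw [zero_sub, enorm_neg] at ht
    refine le_of_tendsto ht ?_
    filter_upwards [Filter.eventually_ge_atTop 1] with R hR
    refine (enorm_sub_le_lintegral_deriv_of_contDiffOn_Icc hψ.contDiffOn hR).trans ?_
    rw [restrict_Ioi_eq_restrict_Ici]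
    exact lintegral_mono_set Set.Icc_subset_Ici_self
  have hm : Measurable (fun r => ‖deriv ψ r‖ₑ) := (measurable_deriv ψ).enorm
  have h2 : ∫⁻ r in Set.Ioi (1 : ℝ), ‖deriv ψ r‖ₑ =
      ∫⁻ r in Set.Ioi (1 : ℝ), ENNReal.ofReal (r⁻¹) * (ENNReal.ofReal r * ‖deriv ψ r‖ₑ) := by
    refine setLIntegral_congr_fun measurableSet_Ioi fun r hr => ?_
    have hr0 : (0 : ℝ) < r := zero_lt_one.trans hr
    rw [← mul_assoc, ← ENNReal.ofReal_mul (by positivity), inv_mul_cancel₀ hr0.ne']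
    simp
  have h3 := ENNReal.lintegral_mul_le_Lp_mul_Lq (volume.restrict (Set.Ioi (1 : ℝ)))
    Real.HolderConjugate.two_two (f := fun r => ENNReal.ofReal (r⁻¹))
    (g := fun r => ENNReal.ofReal r * ‖deriv ψ r‖ₑ) (by fun_prop) (by fun_prop)
  simp only [Pi.mul_apply, ENNReal.rpow_ofNat, lintegral_Ioi_one_inv_sq, ENNReal.one_rpow, one_mul]
    at h3
  calc ‖ψ 1‖ₑ ^ 2 ≤ ((∫⁻ r in Set.Ioi (1 : ℝ),
        (ENNReal.ofReal r * ‖deriv ψ r‖ₑ) ^ 2) ^ (1 / 2 : ℝ)) ^ 2 := by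
        gcongr
        exact h1.trans (h2.le.trans h3)
    _ = _ := by
        rw [← ENNReal.rpow_ofNat, ← ENNReal.rpow_mul]
        simp [mul_pow]

end SchrodFourier

section Paraboloid

variable {V : Type*} [NormedAddCommGroup V] [InnerProductSpace ℝ V] [FiniteDimensional ℝ V]
  [MeasurableSpace V] [BorelSpace V]

theorem lintegral_comp_smul_eq {r : ℝ} (hr : r ≠ 0) {F : V → ℝ≥0∞} (hF : Measurable F) :
    ∫⁻ ξ, F (r • ξ) = ENNReal.ofReal |(r ^ Module.finrank ℝ V)⁻¹| * ∫⁻ η, F η := by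
  rw [← lintegral_map hF (measurable_const_smul r), Measure.map_addHaar_smul volume hr,
    lintegral_smul_measure, smul_eq_mul]

theorem lintegral_paraboloid_le (hV : 3 ≤ Module.finrank ℝ V) {a : ℝ} (ha : a ≠ 0)
    {Ψ : ℝ × V → ℝ≥0∞} (hΨ : Measurable Ψ) :
    ∫⁻ ξ, ∫⁻ r in Set.Ioi (1 : ℝ), ENNReal.ofReal r ^ 2 * (ENNReal.ofReal (‖ξ‖ ^ 2) *
      Ψ (a * ‖ξ‖ ^ 2, r • ξ)) ≤ ENNReal.ofReal (1 / (2 * |a|)) * ∫⁻ τ, ∫⁻ η, Ψ (τ, η) := by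
  rw [lintegral_lintegral_swap (by fun_prop)]
  have h1 : ∀ r ∈ Set.Ioi (1 : ℝ), ∫⁻ ξ, ENNReal.ofReal r ^ 2 * (ENNReal.ofReal (‖ξ‖ ^ 2) *
      Ψ (a * ‖ξ‖ ^ 2, r • ξ)) ≤
      ∫⁻ η, ENNReal.ofReal (1 / (2 * |a|)) * (ENNReal.ofReal |a * ‖η‖ ^ 2 * (-2 * (r ^ 3)⁻¹)| *
        Ψ (a * ‖η‖ ^ 2 * (r ^ 2)⁻¹, η)) := by
    intro r hr
    have hr1 : (1 : ℝ) < r := hr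
    have hr0 : (0 : ℝ) < r := zero_lt_one.trans hr
    have e1 : ∀ ξ : V, ENNReal.ofReal r ^ 2 * (ENNReal.ofReal (‖ξ‖ ^ 2) *
      Ψ (a * ‖ξ‖ ^ 2, r • ξ)) = (fun η : V => ENNReal.ofReal r ^ 2 *
        (ENNReal.ofReal (‖η‖ ^ 2 * (r ^ 2)⁻¹) * Ψ (a * ‖η‖ ^ 2 * (r ^ 2)⁻¹, η))) (r • ξ) := by
      intro ξ
      have : ‖r • ξ‖ ^ 2 * (r ^ 2)⁻¹ = ‖ξ‖ ^ 2 := by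
        rw [norm_smul, Real.norm_eq_abs, mul_pow, sq_abs]
        field_simp
      simp only [mul_assoc, this]
    rw [lintegral_congr e1]
    rw [lintegral_comp_smul_eq hr0.ne' (F := fun η : V => ENNReal.ofReal r ^ 2 *
        (ENNReal.ofReal (‖η‖ ^ 2 * (r ^ 2)⁻¹) * Ψ (a * ‖η‖ ^ 2 * (r ^ 2)⁻¹, η))) (by fun_prop), ← lintegral_const_mul _ (by fun_prop)]
    refine lintegral_mono fun η => ?_
    simp only [← mul_assoc]
    refine mul_le_mul' ?_ le_rfl
    rw [← ENNReal.ofReal_pow hr0.le, ← ENNReal.ofReal_mul (by positivity),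
      ← ENNReal.ofReal_mul (by positivity), ← ENNReal.ofReal_mul (by positivity)]
    apply ENNReal.ofReal_le_ofReal
    rw [abs_of_nonneg (by positivity : 0 ≤ (r ^ Module.finrank ℝ V)⁻¹), abs_mul, abs_mul, abs_mul,
      abs_of_nonneg (by positivity : 0 ≤ (r ^ 3)⁻¹), abs_of_nonneg (by positivity : 0 ≤ ‖η‖ ^ 2)]
    have h3 : (r ^ Module.finrank ℝ V)⁻¹ ≤ (r ^ 3)⁻¹ := by
      gcongr
      exact hr1.le
    have ha' : 0 < |a| := abs_pos.2 ha
    have e2 : (r ^ Module.finrank ℝ V)⁻¹ * r ^ 2 * (‖η‖ ^ 2 * (r ^ 2)⁻¹) =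
      (r ^ Module.finrank ℝ V)⁻¹ * ‖η‖ ^ 2 := by field_simp
    have e3 : 1 / (2 * |a|) * (|a| * ‖η‖ ^ 2 * |(-2 : ℝ)| * (r ^ 3)⁻¹) = (r ^ 3)⁻¹ * ‖η‖ ^ 2 := by
      rw [abs_neg, abs_two]; field_simp
    rw [e2, e3]
    gcongr
  refine (setLIntegral_mono' measurableSet_Ioi h1).trans ?_
  rw [lintegral_lintegral_swap (by fun_prop), lintegral_lintegral_swap (f := fun τ η => Ψ (τ, η))
    (by fun_prop), ← lintegral_const_mul _ (by fun_prop)]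
  refine lintegral_mono fun η => ?_
  dsimp only
  rw [lintegral_const_mul _ (by fun_prop)]
  refine mul_le_mul' le_rfl ?_
  rcases eq_or_ne η 0 with rfl | hη
  · simp
  have hη' : 0 < ‖η‖ ^ 2 := by positivity
  rw [← lintegral_image_eq_lintegral_abs_deriv_mul (f := fun r : ℝ => a * ‖η‖ ^ 2 * (r ^ 2)⁻¹)
    measurableSet_Ioi ?_ ?_ (fun τ => Ψ (τ, η))]
  · exact setLIntegral_le_lintegral _ _
  · intro r hr
    have hr0 : (0 : ℝ) < r := zero_lt_one.trans hr
    refine HasDerivAt.hasDerivWithinAt ?_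
    refine HasDerivAt.const_mul _ ?_
    refine ((hasDerivAt_pow 2 r).inv (pow_ne_zero 2 hr0.ne')).congr_deriv ?_
    field_simp
    push_cast
    ring
  · intro r hr r' hr' h
    have hr0 : (0 : ℝ) < r := zero_lt_one.trans hr
    have hr0' : (0 : ℝ) < r' := zero_lt_one.trans hr'
    have := mul_left_cancel₀ (mul_ne_zero ha hη'.ne') h
    exact (pow_left_inj₀ hr0.le hr0'.le two_ne_zero).1 (inv_injective this)

end Paraboloid

theorem lintegral_enorm_sq_eq {α : Type*} [MeasurableSpace α] {μ : Measure α} (u : α → ℂ) :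
    ∫⁻ x, ‖u x‖ₑ ^ 2 ∂μ = eLpNorm u 2 μ ^ 2 := by
  simpa using (eLpNorm_nnreal_pow_eq_lintegral (f := u) (μ := μ) (p := 2) two_ne_zero).symm

section Radial

variable {V : Type*} [NormedAddCommGroup V] [InnerProductSpace ℝ V] [FiniteDimensional ℝ V]
  [MeasurableSpace V] [BorelSpace V] {ι : Type*} [Fintype ι]

theorem integrable_inner_mul (u : V) {h : V → ℂ} (hh : AEStronglyMeasurable h volume)
    (hxh : Integrable (fun v => ‖v‖ * ‖h v‖) volume) :
    Integrable (fun x => ((⟪u, x⟫_ℝ : ℝ) : ℂ) * h x) volume := by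
  refine (hxh.const_mul ‖u‖).mono' (.mul (by fun_prop) hh) (.of_forall fun x => ?_)
  rw [norm_mul, Complex.norm_real, ← mul_assoc]
  gcongr
  exact norm_inner_le_norm u x

theorem fourier_fourierSMulRight_apply (b : OrthonormalBasis ι ℝ V) {h : V → ℂ}
    (hh : Integrable h volume) (hxh : Integrable (fun v => ‖v‖ * ‖h v‖) volume) (η ξ : V) :
    𝓕 (VectorFourier.fourierSMulRight (innerSL ℝ) h) η ξ =
      -(2 * Real.pi * Complex.I) *
        ∑ j, ((⟪b j, ξ⟫_ℝ : ℝ) : ℂ) * 𝓕 (fun x => ((⟪b j, x⟫_ℝ : ℝ) : ℂ) * h x) η := by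
  have hmul : Integrable (VectorFourier.fourierSMulRight (innerSL ℝ) h) volume := by
    refine (hxh.const_mul (2 * Real.pi * ‖innerSL ℝ (E := V)‖)).mono'
      hh.1.fourierSMulRight (.of_forall fun x => ?_)
    have := VectorFourier.norm_fourierSMulRight_le (innerSL ℝ) h x
    simpa only [mul_assoc] using this
  rw [Real.fourier_continuousLinearMap_apply hmul]
  simp only [Real.fourier_eq]
  have e : ∀ v, 𝐞 (-⟪v, η⟫_ℝ) • (VectorFourier.fourierSMulRight (innerSL ℝ) h v) ξ =
      -(2 * Real.pi * Complex.I) * ∑ j, ((⟪b j, ξ⟫_ℝ : ℝ) : ℂ) *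
        (𝐞 (-⟪v, η⟫_ℝ) • (((⟪b j, v⟫_ℝ : ℝ) : ℂ) * h v)) := by
    intro v
    have e1 : ⟪v, ξ⟫_ℝ = ∑ j, ⟪b j, v⟫_ℝ * ⟪b j, ξ⟫_ℝ := by
      rw [← b.sum_inner_mul_inner v ξ]
      simp only [real_inner_comm]
    rw [VectorFourier.fourierSMulRight_apply, innerSL_apply_apply, e1]
    simp only [Circle.smul_def, smul_eq_mul, Complex.real_smul, Complex.ofReal_sum,
      Finset.mul_sum, Finset.sum_mul, Complex.ofReal_mul]
    refine Finset.sum_congr rfl fun j _ => ?_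
    ring
  rw [integral_congr_ae (.of_forall e), integral_const_mul, integral_finsetSum]
  · simp only [integral_const_mul]
  · intro j _
    refine Integrable.const_mul ?_ _
    exact (Real.fourierIntegral_convergent_iff η).2 (integrable_inner_mul (b j) hh.1 hxh)

theorem sq_enorm_fourier_le (b : OrthonormalBasis ι ℝ V) {h : V → ℂ}
    (hh : Integrable h volume) (hxh : Integrable (fun v => ‖v‖ * ‖h v‖) volume) {ξ : V}
    (hξ : ξ ≠ 0) :
    ‖𝓕 h ξ‖ₑ ^ 2 ≤ ∫⁻ r in Set.Ioi (1 : ℝ), ENNReal.ofReal r ^ 2 * (ENNReal.ofReal (‖ξ‖ ^ 2) *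
      (ENNReal.ofReal ((2 * Real.pi) ^ 2) *
        ∑ j, ‖𝓕 (fun x => ((⟪b j, x⟫_ℝ : ℝ) : ℂ) * h x) (r • ξ)‖ₑ ^ 2)) := by
  have hd : ∀ r : ℝ, HasDerivAt (fun r : ℝ => 𝓕 h (r • ξ))
      (𝓕 (VectorFourier.fourierSMulRight (innerSL ℝ) h) (r • ξ) ξ) r := by
    intro r
    have h1 : HasDerivAt (fun r : ℝ => r • ξ) ξ r := by
      simpa using (hasDerivAt_id r).smul_const ξ
    exact (Real.hasFDerivAt_fourier hh hxh (r • ξ)).comp_hasDerivAt r h1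
  have hc : ContDiff ℝ 1 (fun r : ℝ => 𝓕 h (r • ξ)) := by
    have : ContDiff ℝ ((1 : ℕ∞) : WithTop ℕ∞) (𝓕 h) := by
      refine Real.contDiff_fourier fun k hk => ?_
      have hk' : k ≤ 1 := by exact_mod_cast hk
      interval_cases k
      · simpa using hh.norm
      · simpa using hxh
    exact this.comp (contDiff_id.smul contDiff_const)
  have hlim : Filter.Tendsto (fun r : ℝ => 𝓕 h (r • ξ)) Filter.atTop (nhds 0) := by
    have h1 : Filter.Tendsto (𝓕 h) (Filter.cocompact V) (nhds 0) :=
      tendsto_integral_exp_inner_smul_cocompact h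
    refine h1.comp ?_
    rw [← Metric.cobounded_eq_cocompact, ← tendsto_norm_atTop_iff_cobounded]
    simp only [norm_smul]
    simp only [Real.norm_eq_abs]
    exact Filter.tendsto_abs_atTop_atTop.atTop_mul_const (norm_pos_iff.2 hξ)
  have key := sq_enorm_le_lintegral_deriv hc hlim
  rw [one_smul] at key
  refine key.trans (lintegral_mono fun r => ?_)
  refine mul_le_mul' le_rfl ?_
  rw [(hd r).deriv, fourier_fourierSMulRight_apply b hh hxh]
  set z : ι → ℂ := fun j => 𝓕 (fun x => ((⟪b j, x⟫_ℝ : ℝ) : ℂ) * h x) (r • ξ) with hz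
  have e1 : ‖ξ‖ ^ 2 = ∑ j, ⟪b j, ξ⟫_ℝ ^ 2 := (b.sum_sq_inner_right ξ).symm
  have e2 : ‖-(2 * Real.pi * Complex.I) * ∑ j, ((⟪b j, ξ⟫_ℝ : ℝ) : ℂ) * z j‖ ^ 2 ≤
      ‖ξ‖ ^ 2 * ((2 * Real.pi) ^ 2 * ∑ j, ‖z j‖ ^ 2) := by
    have e3 : ‖∑ j, ((⟪b j, ξ⟫_ℝ : ℝ) : ℂ) * z j‖ ≤ ∑ j, |⟪b j, ξ⟫_ℝ| * ‖z j‖ := by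
      refine (norm_sum_le _ _).trans (le_of_eq ?_)
      simp
    have e4 := Finset.sum_mul_sq_le_sq_mul_sq Finset.univ (fun j => |⟪b j, ξ⟫_ℝ|) (fun j => ‖z j‖)
    simp only [sq_abs, ← e1] at e4
    have e5 : ‖-(2 * Real.pi * Complex.I)‖ = 2 * Real.pi := by
      simp [abs_of_pos Real.pi_pos]
    rw [norm_mul, e5, mul_pow]
    calc (2 * Real.pi) ^ 2 * ‖∑ j, ((⟪b j, ξ⟫_ℝ : ℝ) : ℂ) * z j‖ ^ 2
        ≤ (2 * Real.pi) ^ 2 * (∑ j, |⟪b j, ξ⟫_ℝ| * ‖z j‖) ^ 2 := by gcongr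
      _ ≤ (2 * Real.pi) ^ 2 * (‖ξ‖ ^ 2 * ∑ j, ‖z j‖ ^ 2) := by gcongr
      _ = _ := by ring
  have e6 : ∀ c : ℂ, ‖c‖ₑ ^ 2 = ENNReal.ofReal (‖c‖ ^ 2) := fun c => by
    rw [← ofReal_norm, ENNReal.ofReal_pow (norm_nonneg _)]
  simp only [e6]
  rw [← ENNReal.ofReal_sum_of_nonneg (fun _ _ => by positivity),
    ← ENNReal.ofReal_mul (by positivity), ← ENNReal.ofReal_mul (by positivity)]
  exact ENNReal.ofReal_le_ofReal e2

theorem lintegral_sum_sq_fourier_le (b : OrthonormalBasis ι ℝ V) {h : V → ℂ}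
    (hh : Integrable h volume) (hxh : Integrable (fun v => ‖v‖ * ‖h v‖) volume)
    (hxh2 : MemLp (fun v => ‖v‖ * ‖h v‖) 2 volume) :
    ∫⁻ η, ∑ j, ‖𝓕 (fun x => ((⟪b j, x⟫_ℝ : ℝ) : ℂ) * h x) η‖ₑ ^ 2 ≤
      ∫⁻ x, ENNReal.ofReal (‖x‖ ^ 2) * ‖h x‖ₑ ^ 2 := by
  have hj : ∀ j, Integrable (fun x => ((⟪b j, x⟫_ℝ : ℝ) : ℂ) * h x) volume :=
    fun j => integrable_inner_mul (b j) hh.1 hxh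
  have hj2 : ∀ j, MemLp (fun x => ((⟪b j, x⟫_ℝ : ℝ) : ℂ) * h x) 2 volume := by
    intro j
    refine hxh2.mono (hj j).1 (.of_forall fun x => ?_)
    rw [norm_mul, Complex.norm_real, norm_mul, norm_norm, norm_norm]
    gcongr
    simpa using norm_inner_le_norm (𝕜 := ℝ) (b j) x
  rw [lintegral_finsetSum _ (fun j _ => by
    have := continuous_fourier (hj j); fun_prop)]
  calc ∑ j, ∫⁻ η, ‖𝓕 (fun x => ((⟪b j, x⟫_ℝ : ℝ) : ℂ) * h x) η‖ₑ ^ 2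
      ≤ ∑ j, ∫⁻ x, ‖((⟪b j, x⟫_ℝ : ℝ) : ℂ) * h x‖ₑ ^ 2 := by
        refine Finset.sum_le_sum fun j _ => ?_
        rw [lintegral_enorm_sq_eq, lintegral_enorm_sq_eq]
        gcongr
        exact eLpNorm_fourier_le (hj j) (hj2 j)
    _ = ∫⁻ x, ∑ j, ‖((⟪b j, x⟫_ℝ : ℝ) : ℂ) * h x‖ₑ ^ 2 := by
        rw [lintegral_finsetSum' _ fun j _ => (hj j).1.enorm.pow_const 2]
    _ = _ := by
        refine lintegral_congr fun x => ?_
        rw [← b.sum_sq_inner_right x, ENNReal.ofReal_sum_of_nonneg (fun _ _ => by positivity),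
          Finset.sum_mul]
        refine Finset.sum_congr rfl fun j _ => ?_
        rw [enorm_mul, mul_pow]
        congr 1
        rw [← ofReal_norm, Complex.norm_real, ← ENNReal.ofReal_pow (norm_nonneg _),
          Real.norm_eq_abs, sq_abs]

end Radial

theorem continuous_fourierChar_comp {X : Type*} [TopologicalSpace X] {u : X → ℝ}
    (hu : Continuous u) : Continuous fun x => 𝐞 (u x) :=
  Real.continuous_fourierChar.comp hu

section Product

variable {V : Type*} [NormedAddCommGroup V] [InnerProductSpace ℝ V] [FiniteDimensional ℝ V]
  [MeasurableSpace V] [BorelSpace V]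

/-- `H` is measurable and dominated by a product `p s * q x`, where `p`, `q` and `‖x‖ * q x` all
lie in `L¹ ∩ L²`. -/
structure ProductBound (H : ℝ × V → ℂ) (p : ℝ → ℝ) (q : V → ℝ) : Prop where
  stronglyMeasurable : StronglyMeasurable H
  norm_le : ∀ s x, ‖H (s, x)‖ ≤ p s * q x
  integrable_left : Integrable p volume
  memLp_left : MemLp p 2 volume
  integrable_right : Integrable q volume
  memLp_right : MemLp q 2 volume
  integrable_norm_mul_right : Integrable (fun x => ‖x‖ * q x) volume
  memLp_norm_mul_right : MemLp (fun x => ‖x‖ * q x) 2 volume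

namespace ProductBound

variable {H : ℝ × V → ℂ} {p : ℝ → ℝ} {q : V → ℝ}

theorem norm_le_norm (hH : ProductBound H p q) (s : ℝ) (x : V) :
    ‖H (s, x)‖ ≤ ‖p s‖ * ‖q x‖ := by
  rw [← norm_mul]
  exact (hH.norm_le s x).trans (le_abs_self _)

theorem integrable_slice (hH : ProductBound H p q) (s : ℝ) :
    Integrable (fun x => H (s, x)) volume := by
  refine (hH.integrable_right.norm.const_mul ‖p s‖).mono'
    (hH.stronglyMeasurable.comp_measurable (by fun_prop)).aestronglyMeasurable
    (.of_forall (hH.norm_le_norm s))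

theorem memLp_slice (hH : ProductBound H p q) (s : ℝ) :
    MemLp (fun x => H (s, x)) 2 volume := by
  refine (hH.memLp_right.const_mul (p s)).mono
    (hH.stronglyMeasurable.comp_measurable (by fun_prop)).aestronglyMeasurable
    (.of_forall fun x => ?_)
  rw [norm_mul]
  exact hH.norm_le_norm s x

theorem integrable_time (hH : ProductBound H p q) (x : V) :
    Integrable (fun s => H (s, x)) volume := by
  refine (hH.integrable_left.norm.mul_const ‖q x‖).mono'
    (hH.stronglyMeasurable.comp_measurable (by fun_prop)).aestronglyMeasurable
    (.of_forall fun s => hH.norm_le_norm s x)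

theorem memLp_time (hH : ProductBound H p q) (x : V) :
    MemLp (fun s => H (s, x)) 2 volume := by
  refine (hH.memLp_left.mul_const (q x)).mono
    (hH.stronglyMeasurable.comp_measurable (by fun_prop)).aestronglyMeasurable
    (.of_forall fun s => ?_)
  rw [norm_mul]
  exact hH.norm_le_norm s x

theorem stronglyMeasurable_fourier_time (hH : ProductBound H p q) :
    StronglyMeasurable (fun z : ℝ × V => 𝓕 (fun s => H (s, z.2)) z.1) := by
  simp only [Real.fourier_eq]
  refine StronglyMeasurable.integral_prod_right
    (f := fun (z : ℝ × V) (s : ℝ) => 𝐞 (-⟪s, z.1⟫_ℝ) • H (s, z.2)) ?_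
  have hc : Continuous fun w : (ℝ × V) × ℝ => 𝐞 (-⟪w.2, w.1.1⟫_ℝ) := continuous_fourierChar_comp (by fun_prop)
  exact hc.stronglyMeasurable.smul
    (hH.stronglyMeasurable.comp_measurable (g := fun w : (ℝ × V) × ℝ => (w.2, w.1.2)) (by fun_prop))

theorem stronglyMeasurable_fourier_space (hH : ProductBound H p q) :
    StronglyMeasurable (fun z : ℝ × V => 𝓕 (fun x => H (z.1, x)) z.2) := by
  simp only [Real.fourier_eq]
  refine StronglyMeasurable.integral_prod_right
    (f := fun (z : ℝ × V) (x : V) => 𝐞 (-⟪x, z.2⟫_ℝ) • H (z.1, x)) ?_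
  have hc : Continuous fun w : (ℝ × V) × V => 𝐞 (-⟪w.2, w.1.2⟫_ℝ) := continuous_fourierChar_comp (by fun_prop)
  exact hc.stronglyMeasurable.smul
    (hH.stronglyMeasurable.comp_measurable (g := fun w : (ℝ × V) × V => (w.1.1, w.2)) (by fun_prop))

theorem norm_fourier_time_le (hH : ProductBound H p q) (τ : ℝ) (x : V) :
    ‖𝓕 (fun s => H (s, x)) τ‖ ≤ (∫ s, ‖p s‖) * ‖q x‖ := by
  refine (fourier_norm_le τ).trans ?_
  rw [← integral_mul_const]
  exact integral_mono (hH.integrable_time x).norm (hH.integrable_left.norm.mul_const _)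
    fun s => hH.norm_le_norm s x

theorem integrable_fourier_time (hH : ProductBound H p q) (τ : ℝ) :
    Integrable (fun x => 𝓕 (fun s => H (s, x)) τ) volume :=
  (hH.integrable_right.norm.const_mul _).mono'
    (hH.stronglyMeasurable_fourier_time.comp_measurable
      (g := fun x : V => (τ, x)) (by fun_prop)).aestronglyMeasurable
    (.of_forall (hH.norm_fourier_time_le τ))

theorem norm_mul_fourier_time_le (hH : ProductBound H p q) (τ : ℝ) (x : V) :
    ‖‖x‖ * ‖𝓕 (fun s => H (s, x)) τ‖‖ ≤ (∫ s, ‖p s‖) * ‖‖x‖ * q x‖ := by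
  rw [norm_mul, norm_mul, norm_norm, norm_norm]
  calc _ ≤ ‖x‖ * ((∫ s, ‖p s‖) * ‖q x‖) := by
        gcongr
        exact hH.norm_fourier_time_le τ x
    _ = _ := by ring

theorem aestronglyMeasurable_norm_mul_fourier_time (hH : ProductBound H p q) (τ : ℝ) :
    AEStronglyMeasurable (fun x => ‖x‖ * ‖𝓕 (fun s => H (s, x)) τ‖) volume :=
  .mul (by fun_prop) (hH.integrable_fourier_time τ).1.norm

theorem integrable_norm_mul_fourier_time (hH : ProductBound H p q) (τ : ℝ) :
    Integrable (fun x => ‖x‖ * ‖𝓕 (fun s => H (s, x)) τ‖) volume :=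
  (hH.integrable_norm_mul_right.norm.const_mul _).mono'
    (hH.aestronglyMeasurable_norm_mul_fourier_time τ)
    (.of_forall (hH.norm_mul_fourier_time_le τ))

theorem memLp_norm_mul_fourier_time (hH : ProductBound H p q) (τ : ℝ) :
    MemLp (fun x => ‖x‖ * ‖𝓕 (fun s => H (s, x)) τ‖) 2 volume :=
  (hH.memLp_norm_mul_right.const_mul (∫ s, ‖p s‖)).mono
    (hH.aestronglyMeasurable_norm_mul_fourier_time τ)
    (.of_forall fun x => by
      rw [norm_mul (∫ s, ‖p s‖), Real.norm_of_nonneg (integral_nonneg fun _ => norm_nonneg _)]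
      exact hH.norm_mul_fourier_time_le τ x)

theorem lintegral_fourier_time_le (hH : ProductBound H p q) :
    ∫⁻ τ : ℝ, ∫⁻ x : V, ENNReal.ofReal (‖x‖ ^ 2) * ‖𝓕 (fun s => H (s, x)) τ‖ₑ ^ 2 ≤
      ∫⁻ s : ℝ, ∫⁻ x : V, ENNReal.ofReal (‖x‖ ^ 2) * ‖H (s, x)‖ₑ ^ 2 := by
  have m1 : Measurable (fun z : ℝ × V => 𝓕 (fun s => H (s, z.2)) z.1) :=
    hH.stronglyMeasurable_fourier_time.measurable
  have m2 : Measurable H := hH.stronglyMeasurable.measurable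
  have m5 : Measurable fun z : ℝ × V => ENNReal.ofReal (‖z.2‖ ^ 2) := by fun_prop
  have m6 : Measurable (Function.uncurry fun (s : ℝ) (x : V) =>
      ENNReal.ofReal (‖x‖ ^ 2) * ‖H (s, x)‖ₑ ^ 2) := m5.mul (m2.enorm.pow_const 2)
  rw [lintegral_lintegral_swap (m5.mul (m1.enorm.pow_const 2)).aemeasurable,
    lintegral_lintegral_swap m6.aemeasurable]
  refine lintegral_mono fun x => ?_
  dsimp only
  have m3 : Measurable (fun τ => ‖𝓕 (fun s => H (s, x)) τ‖ₑ ^ 2) :=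
    (m1.comp (measurable_id.prodMk measurable_const)).enorm.pow_const 2
  have m4 : Measurable (fun s => ‖H (s, x)‖ₑ ^ 2) :=
    (m2.comp (measurable_id.prodMk measurable_const)).enorm.pow_const 2
  rw [lintegral_const_mul _ m3, lintegral_const_mul _ m4]
  refine mul_le_mul' le_rfl ?_
  rw [lintegral_enorm_sq_eq, lintegral_enorm_sq_eq]
  gcongr
  exact eLpNorm_fourier_le (hH.integrable_time x) (hH.memLp_time x)

theorem lintegral_paraboloid_fourier_le (hH : ProductBound H p q) (hV : 3 ≤ Module.finrank ℝ V)
    {a : ℝ} (ha : a ≠ 0) :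
    ∫⁻ ξ : V, ‖𝓕 (fun x => 𝓕 (fun s => H (s, x)) (a * ‖ξ‖ ^ 2)) ξ‖ₑ ^ 2 ≤
      ENNReal.ofReal (1 / (2 * |a|)) * (ENNReal.ofReal ((2 * Real.pi) ^ 2) *
        ∫⁻ s : ℝ, ∫⁻ x : V, ENNReal.ofReal (‖x‖ ^ 2) * ‖H (s, x)‖ₑ ^ 2) := by
  have : Nontrivial V := Module.nontrivial_of_finrank_pos (R := ℝ) (by omega)
  let b := stdOrthonormalBasis ℝ V
  let Ψ : ℝ × V → ℝ≥0∞ := fun z => ENNReal.ofReal ((2 * Real.pi) ^ 2) *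
    ∑ j, ‖𝓕 (fun x => ((⟪b j, x⟫_ℝ : ℝ) : ℂ) * 𝓕 (fun s => H (s, x)) z.1) z.2‖ₑ ^ 2
  have hΨ : Measurable Ψ := by
    refine Measurable.const_mul (Finset.measurable_sum _ fun j _ => ?_) _
    refine Measurable.pow_const (Measurable.enorm (StronglyMeasurable.measurable ?_)) 2
    simp only [Real.fourier_eq (E := ℂ) (V := V)]
    refine StronglyMeasurable.integral_prod_right
      (f := fun (z : ℝ × V) (x : V) => 𝐞 (-⟪x, z.2⟫_ℝ) • (((⟪b j, x⟫_ℝ : ℝ) : ℂ) *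
        𝓕 (fun s => H (s, x)) z.1)) ?_
    have hc : Continuous fun w : (ℝ × V) × V => 𝐞 (-⟪w.2, w.1.2⟫_ℝ) :=
      continuous_fourierChar_comp (by fun_prop)
    have hi : Continuous fun w : (ℝ × V) × V => ((⟪b j, w.2⟫_ℝ : ℝ) : ℂ) := by fun_prop
    exact hc.stronglyMeasurable.smul (hi.stronglyMeasurable.mul
      (hH.stronglyMeasurable_fourier_time.comp_measurable
        (g := fun w : (ℝ × V) × V => (w.1.1, w.2)) (by fun_prop)))
  have hne : ∀ᵐ ξ : V, ξ ≠ 0 := by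
    simp [ae_iff]
  calc _ ≤ ∫⁻ ξ : V, ∫⁻ r in Set.Ioi (1 : ℝ), ENNReal.ofReal r ^ 2 *
        (ENNReal.ofReal (‖ξ‖ ^ 2) * Ψ (a * ‖ξ‖ ^ 2, r • ξ)) := by
        refine lintegral_mono_ae (hne.mono fun ξ hξ => ?_)
        exact sq_enorm_fourier_le b (hH.integrable_fourier_time _)
          (hH.integrable_norm_mul_fourier_time _) hξ
    _ ≤ ENNReal.ofReal (1 / (2 * |a|)) * ∫⁻ τ, ∫⁻ η, Ψ (τ, η) := lintegral_paraboloid_le hV ha hΨ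
    _ ≤ _ := by
        gcongr
        refine le_trans ?_ (mul_le_mul' le_rfl hH.lintegral_fourier_time_le)
        rw [← lintegral_const_mul' _ _ ENNReal.ofReal_ne_top]
        refine lintegral_mono fun τ => ?_
        dsimp only [Ψ]
        rw [lintegral_const_mul' _ _ ENNReal.ofReal_ne_top]
        refine mul_le_mul' le_rfl ?_
        exact lintegral_sum_sq_fourier_le b (hH.integrable_fourier_time τ)
          (hH.integrable_norm_mul_fourier_time τ) (hH.memLp_norm_mul_fourier_time τ)

theorem fourier_fourier_eq_integral (hH : ProductBound H p q) (τ : ℝ) (ξ : V) :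
    𝓕 (fun x => 𝓕 (fun s => H (s, x)) τ) ξ =
      ∫ s : ℝ, 𝐞 (-(s * τ)) • 𝓕 (fun x => H (s, x)) ξ := by
  simp only [Real.fourier_eq, Circle.smul_def, smul_eq_mul, ← integral_const_mul]
  rw [integral_integral_swap]
  · refine integral_congr_ae (.of_forall fun s => integral_congr_ae (.of_forall fun x => ?_))
    dsimp only
    rw [show ⟪s, τ⟫_ℝ = s * τ by simp [mul_comm]]
    ring
  · refine (hH.integrable_right.norm.mul_prod hH.integrable_left.norm).mono' ?_
      (.of_forall fun z => ?_)
    · have h1 : Continuous fun z : V × ℝ => ((𝐞 (-⟪z.1, ξ⟫_ℝ) : Circle) : ℂ) :=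
        continuous_subtype_val.comp (continuous_fourierChar_comp (by fun_prop))
      have h2 : Continuous fun z : V × ℝ => ((𝐞 (-⟪z.2, τ⟫_ℝ) : Circle) : ℂ) :=
        continuous_subtype_val.comp (continuous_fourierChar_comp (by fun_prop))
      exact (h1.stronglyMeasurable.mul (h2.stronglyMeasurable.mul
        (hH.stronglyMeasurable.comp_measurable
          (g := fun w : V × ℝ => (w.2, w.1)) (by fun_prop)))).aestronglyMeasurable
    · simp only [Function.uncurry_def, norm_mul, Circle.norm_coe, one_mul]
      rw [mul_comm]
      exact hH.norm_le_norm _ _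

end ProductBound

end Product

section Propagator

variable {n : ℕ}

theorem stronglyMeasurable_schrod {H : ℝ × EuclideanSpace ℝ (Fin n) → ℂ}
    (hH : StronglyMeasurable H) :
    StronglyMeasurable fun z : ℝ × EuclideanSpace ℝ (Fin n) =>
      schrod n (-z.1) (fun y => H (z.1, y)) z.2 := by
  unfold schrod
  refine StronglyMeasurable.ite ?_ hH (StronglyMeasurable.mul ?_ ?_)
  · exact measurableSet_eq_fun (by fun_prop) measurable_const
  · exact Measurable.stronglyMeasurable (by fun_prop)
  · have hk : Measurable fun w : (ℝ × EuclideanSpace ℝ (Fin n)) × EuclideanSpace ℝ (Fin n) =>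
        Complex.exp (Complex.I * (‖w.1.2 - w.2‖ : ℂ) ^ 2 / (4 * ((-w.1.1 : ℝ) : ℂ))) := by
      fun_prop
    exact StronglyMeasurable.integral_prod_right (hk.stronglyMeasurable.mul
      (hH.comp_measurable (g := fun w : (ℝ × EuclideanSpace ℝ (Fin n)) ×
        EuclideanSpace ℝ (Fin n) => (w.1.1, w.2)) (by fun_prop)))

theorem stronglyMeasurable_schrod_slice (t : ℝ) {h : EuclideanSpace ℝ (Fin n) → ℂ}
    (hh : StronglyMeasurable h) : StronglyMeasurable (schrod n t h) := by
  have := stronglyMeasurable_schrod (H := fun z => h z.2) (hh.comp_measurable measurable_snd)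
  simpa [Function.comp_def] using this.comp_measurable (g := fun x : EuclideanSpace ℝ (Fin n) => (-t, x))
    (by fun_prop)

theorem norm_schrod_le {t : ℝ} (ht : t ≠ 0) (h : EuclideanSpace ℝ (Fin n) → ℂ)
    (x : EuclideanSpace ℝ (Fin n)) :
    ‖schrod n t h x‖ ≤
      ‖(4 * Real.pi * Complex.I * (t : ℂ)) ^ (-(n : ℂ) / 2)‖ * ∫ y, ‖h y‖ := by
  rw [schrod, if_neg ht, norm_mul]
  gcongr
  refine (norm_integral_le_integral_norm _).trans (le_of_eq ?_)
  refine integral_congr_ae (.of_forall fun y => ?_)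
  have : Complex.I * (‖x - y‖ : ℂ) ^ 2 / (4 * (t : ℂ)) =
      ((‖x - y‖ ^ 2 / (4 * t) : ℝ) : ℂ) * Complex.I := by
    push_cast
    ring
  simp only [norm_mul]
  rw [this, Complex.norm_exp_ofReal_mul_I, one_mul]

theorem eLpNorm_schrod_le (t : ℝ) {h : EuclideanSpace ℝ (Fin n) → ℂ}
    (hm : StronglyMeasurable h) (h1 : Integrable h volume) (h2 : MemLp h 2 volume) :
    eLpNorm (schrod n t h) 2 volume ≤ eLpNorm h 2 volume := by
  rcases eq_or_ne t 0 with rfl | ht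
  · refine le_of_eq (congrArg (eLpNorm · 2 volume) ?_)
    ext x
    simp [schrod]
  rw [← ENNReal.ofReal_toReal h2.eLpNorm_ne_top]
  have hs := (stronglyMeasurable_schrod_slice t hm).aestronglyMeasurable (μ := volume)
  refine eLpNorm_two_le_of_forall_schwartz (locallyIntegrable_of_bounded hs (norm_schrod_le ht h))
    (integrable_schwartz_mul hs (norm_schrod_le ht h)) ENNReal.toReal_nonneg fun f => ?_
  obtain ⟨φ, rfl⟩ : ∃ φ : 𝓢(EuclideanSpace ℝ (Fin n), ℂ), 𝓕 φ = f :=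
    ⟨𝓕⁻ f, FourierTransform.fourier_fourierInv_eq f⟩
  rw [SchwartzMap.norm_fourier_toL2_eq, SchwartzMap.norm_toLp,
    integral_fourier_mul_schrod ht φ h1]
  have hexp : ∀ ξ : EuclideanSpace ℝ (Fin n),
      ‖Complex.exp (((-(4 * Real.pi ^ 2 * t * ‖ξ‖ ^ 2) : ℝ) : ℂ) * Complex.I) * φ ξ‖ = ‖φ ξ‖ := by
    intro ξ
    rw [norm_mul, Complex.norm_exp_ofReal_mul_I, one_mul]
  have hφ : MemLp (fun ξ => Complex.exp (((-(4 * Real.pi ^ 2 * t * ‖ξ‖ ^ 2) : ℝ) : ℂ) *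
      Complex.I) * φ ξ) 2 volume := by
    refine (φ.memLp 2 volume).mono ?_ (.of_forall fun ξ => (hexp ξ).le)
    have := φ.continuous
    exact Continuous.aestronglyMeasurable (by fun_prop)
  have hF : MemLp (𝓕 h) 2 volume :=
    ⟨(continuous_fourier h1).aestronglyMeasurable,
      (eLpNorm_fourier_le h1 h2).trans_lt h2.eLpNorm_lt_top⟩
  refine (norm_integral_mul_le_of_memLp hφ hF).trans ?_
  have e1 : eLpNorm (fun ξ => Complex.exp (((-(4 * Real.pi ^ 2 * t * ‖ξ‖ ^ 2) : ℝ) : ℂ) *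
      Complex.I) * φ ξ) 2 volume = eLpNorm φ 2 volume :=
    eLpNorm_congr_norm_ae (.of_forall hexp)
  rw [e1]
  gcongr
  · exact h2.eLpNorm_ne_top
  · exact eLpNorm_fourier_le h1 h2

namespace ProductBound

variable {H : ℝ × EuclideanSpace ℝ (Fin n) → ℂ} {p : ℝ → ℝ} {q : EuclideanSpace ℝ (Fin n) → ℝ}

theorem eLpNorm_schrod_slice_le (hH : ProductBound H p q) (s : ℝ) :
    eLpNorm (schrod n (-s) fun y => H (s, y)) 2 volume ≤ ‖p s‖ₑ * eLpNorm q 2 volume := by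
  refine (eLpNorm_schrod_le (-s) (hH.stronglyMeasurable.comp_measurable (by fun_prop))
    (hH.integrable_slice s) (hH.memLp_slice s)).trans ?_
  have : eLpNorm (fun y => p s * q y) 2 volume = ‖p s‖ₑ * eLpNorm q 2 volume :=
    eLpNorm_const_smul (p s) q 2 volume
  rw [← this]
  refine eLpNorm_mono fun y => ?_
  rw [norm_mul]
  exact hH.norm_le_norm s y

theorem integrable_mul_schrod (hH : ProductBound H p q) {v : EuclideanSpace ℝ (Fin n) → ℂ}
    (hv : MemLp v 2 volume) :
    Integrable (fun z : ℝ × EuclideanSpace ℝ (Fin n) =>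
      v z.2 * schrod n (-z.1) (fun y => H (z.1, y)) z.2) (volume.prod volume) := by
  have hsm := stronglyMeasurable_schrod hH.stronglyMeasurable
  have hm : AEStronglyMeasurable (fun z : ℝ × EuclideanSpace ℝ (Fin n) =>
      v z.2 * schrod n (-z.1) (fun y => H (z.1, y)) z.2) (volume.prod volume) :=
    (hv.1.comp_snd).mul hsm.aestronglyMeasurable
  refine ⟨hm, ?_⟩
  rw [hasFiniteIntegral_iff_enorm, lintegral_prod _ hm.enorm]
  calc ∫⁻ s, ∫⁻ x, ‖v x * schrod n (-s) (fun y => H (s, y)) x‖ₑ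
      ≤ ∫⁻ s, eLpNorm v 2 volume * eLpNorm q 2 volume * ‖p s‖ₑ := by
        refine lintegral_mono fun s => ?_
        have h := eLpNorm_smul_le_mul_eLpNorm (p := 2) (q := 2) (r := 1) (μ := volume)
          (hsm.comp_measurable (g := fun x : EuclideanSpace ℝ (Fin n) => (s, x))
            (by fun_prop)).aestronglyMeasurable hv.1
        rw [eLpNorm_one_eq_lintegral_enorm] at h
        refine h.trans ?_
        rw [mul_assoc, mul_comm (eLpNorm q 2 volume)]
        exact mul_le_mul' le_rfl (hH.eLpNorm_schrod_slice_le s)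
    _ = eLpNorm v 2 volume * eLpNorm q 2 volume * ∫⁻ s, ‖p s‖ₑ :=
        lintegral_const_mul' _ _
          (ENNReal.mul_ne_top hv.eLpNorm_ne_top hH.memLp_right.eLpNorm_ne_top)
    _ < ⊤ := ENNReal.mul_lt_top
        (ENNReal.mul_lt_top hv.eLpNorm_lt_top hH.memLp_right.eLpNorm_lt_top)
        hH.integrable_left.2

theorem integrable_mul_integral_schrod (hH : ProductBound H p q)
    {v : EuclideanSpace ℝ (Fin n) → ℂ} (hv : MemLp v 2 volume) :
    Integrable (fun x => v x * ∫ s, schrod n (-s) (fun y => H (s, y)) x) volume := by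
  simpa only [integral_const_mul] using (hH.integrable_mul_schrod hv).integral_prod_right

theorem locallyIntegrable_integral_schrod (hH : ProductBound H p q) :
    LocallyIntegrable (fun x => ∫ s, schrod n (-s) (fun y => H (s, y)) x) volume := by
  rw [locallyIntegrable_iff]
  intro K hK
  have hv : MemLp (K.indicator fun _ => (1 : ℂ)) 2 (volume : Measure (EuclideanSpace ℝ (Fin n))) :=
    memLp_indicator_const 2 hK.measurableSet 1 (.inr hK.measure_lt_top.ne)
  rw [← integrable_indicator_iff hK.measurableSet]
  refine (hH.integrable_mul_integral_schrod hv).congr (.of_forall fun x => ?_)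
  by_cases hx : x ∈ K <;> simp [hx]

theorem integral_fourier_mul_integral_schrod (hH : ProductBound H p q)
    (φ : 𝓢(EuclideanSpace ℝ (Fin n), ℂ)) :
    ∫ x, 𝓕 φ x * ∫ s, schrod n (-s) (fun y => H (s, y)) x =
      ∫ ξ, φ ξ * 𝓕 (fun x => 𝓕 (fun s => H (s, x)) (-(2 * Real.pi) * ‖ξ‖ ^ 2)) ξ := by
  have h1 := hH.integrable_mul_schrod ((𝓕 φ : 𝓢(EuclideanSpace ℝ (Fin n), ℂ)).memLp 2 volume)
  have hc : Continuous fun w : ℝ × EuclideanSpace ℝ (Fin n) =>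
      ((𝐞 (-(w.1 * (-(2 * Real.pi) * ‖w.2‖ ^ 2))) : Circle) : ℂ) :=
    continuous_subtype_val.comp (continuous_fourierChar_comp (by fun_prop))
  have h2 : Integrable (fun w : ℝ × EuclideanSpace ℝ (Fin n) =>
      φ w.2 * (((𝐞 (-(w.1 * (-(2 * Real.pi) * ‖w.2‖ ^ 2))) : Circle) : ℂ) *
        𝓕 (fun x => H (w.1, x)) w.2)) (volume.prod volume) := by
    refine ((hH.integrable_left.norm.mul_const (∫ x, ‖q x‖)).mul_prod φ.integrable.norm).mono'
      ((φ.continuous.comp continuous_snd).stronglyMeasurable.mul (hc.stronglyMeasurable.mul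
        hH.stronglyMeasurable_fourier_space)).aestronglyMeasurable (.of_forall fun w => ?_)
    rw [norm_mul, norm_mul, Circle.norm_coe, one_mul, mul_comm]
    gcongr
    refine (fourier_norm_le _).trans ?_
    rw [← integral_const_mul]
    exact integral_mono (hH.integrable_slice _).norm (hH.integrable_right.norm.const_mul _)
      fun x => hH.norm_le_norm _ x
  have hne : ∀ᵐ s : ℝ, s ≠ 0 := by simp [ae_iff]
  simp only [hH.fourier_fourier_eq_integral, Circle.smul_def, smul_eq_mul, ← integral_const_mul]
  refine (integral_integral_swap (f := fun (s : ℝ) (x : EuclideanSpace ℝ (Fin n)) =>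
    𝓕 φ x * schrod n (-s) (fun y => H (s, y)) x) h1).symm.trans
    (Eq.trans ?_ (integral_integral_swap (f := fun (s : ℝ) (ξ : EuclideanSpace ℝ (Fin n)) =>
      φ ξ * (((𝐞 (-(s * (-(2 * Real.pi) * ‖ξ‖ ^ 2))) : Circle) : ℂ) *
        𝓕 (fun x => H (s, x)) ξ)) h2))
  refine integral_congr_ae (hne.mono fun s hs => ?_)
  dsimp only
  rw [integral_fourier_mul_schrod (neg_ne_zero.2 hs) φ
    (hH.integrable_slice s)]
  refine integral_congr_ae (.of_forall fun ξ => ?_)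
  dsimp only
  rw [Real.fourierChar_apply, mul_comm (Complex.exp _), mul_assoc]
  congr 4
  push_cast
  ring

theorem eLpNorm_integral_schrod_le (hH : ProductBound H p q) :
    eLpNorm (fun x => ∫ s, schrod n (-s) (fun y => H (s, y)) x) 2 volume ≤
      eLpNorm (fun ξ : EuclideanSpace ℝ (Fin n) =>
        𝓕 (fun x => 𝓕 (fun s => H (s, x)) (-(2 * Real.pi) * ‖ξ‖ ^ 2)) ξ) 2 volume := by
  set Φ : EuclideanSpace ℝ (Fin n) → ℂ :=
    fun ξ => 𝓕 (fun x => 𝓕 (fun s => H (s, x)) (-(2 * Real.pi) * ‖ξ‖ ^ 2)) ξ with hΦdef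
  rcases eq_or_ne (eLpNorm Φ 2 volume) ⊤ with htop | htop
  · simp [htop]
  have hΦ : MemLp Φ 2 volume := by
    refine ⟨StronglyMeasurable.aestronglyMeasurable ?_, htop.lt_top⟩
    simp only [hΦdef, hH.fourier_fourier_eq_integral]
    have hc : Continuous fun w : EuclideanSpace ℝ (Fin n) × ℝ =>
        𝐞 (-(w.2 * (-(2 * Real.pi) * ‖w.1‖ ^ 2))) := continuous_fourierChar_comp (by fun_prop)
    exact StronglyMeasurable.integral_prod_right (hc.stronglyMeasurable.smul
      (hH.stronglyMeasurable_fourier_space.comp_measurable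
        (g := fun w : EuclideanSpace ℝ (Fin n) × ℝ => (w.2, w.1)) (by fun_prop)))
  rw [← ENNReal.ofReal_toReal htop]
  refine eLpNorm_two_le_of_forall_schwartz hH.locallyIntegrable_integral_schrod
    (fun f => hH.integrable_mul_integral_schrod (f.memLp 2 volume)) ENNReal.toReal_nonneg
    fun f => ?_
  obtain ⟨φ, rfl⟩ : ∃ φ : 𝓢(EuclideanSpace ℝ (Fin n), ℂ), 𝓕 φ = f :=
    ⟨𝓕⁻ f, FourierTransform.fourier_fourierInv_eq f⟩
  rw [SchwartzMap.norm_fourier_toL2_eq, SchwartzMap.norm_toLp,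
    hH.integral_fourier_mul_integral_schrod φ]
  exact norm_integral_mul_le_of_memLp (φ.memLp 2 volume) hΦ

theorem sq_eLpNorm_integral_schrod_le (hH : ProductBound H p q) (hn : 3 ≤ n) :
    eLpNorm (fun x => ∫ s, schrod n (-s) (fun y => H (s, y)) x) 2 volume ^ 2 ≤
      ENNReal.ofReal Real.pi *
        ∫⁻ s : ℝ, ∫⁻ x, ENNReal.ofReal (‖x‖ ^ 2) * ‖H (s, x)‖ₑ ^ 2 := by
  have hpi := Real.pi_pos
  have ha : -(2 * Real.pi) ≠ 0 := by
    rw [neg_ne_zero]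
    positivity
  refine (pow_le_pow_left' hH.eLpNorm_integral_schrod_le 2).trans ?_
  rw [← lintegral_enorm_sq_eq]
  refine (hH.lintegral_paraboloid_fourier_le (by simpa using hn) ha).trans (le_of_eq ?_)
  rw [← mul_assoc, ← ENNReal.ofReal_mul (by positivity), abs_neg, abs_of_pos (by positivity)]
  congr 2
  field_simp

end ProductBound

end Propagator

theorem exists_norm_le_mul_inv_pow {E F : Type*} [NormedAddCommGroup E] [NormedSpace ℝ E]
    [NormedAddCommGroup F] [NormedSpace ℝ F] (g : 𝓢(E × F, ℂ)) (k l : ℕ) :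
    ∃ K : ℝ, 0 ≤ K ∧ ∀ s x, ‖g (s, x)‖ ≤ K * ((1 + ‖s‖) ^ k)⁻¹ * ((1 + ‖x‖) ^ l)⁻¹ := by
  set K : ℝ := 2 ^ (k + l) *
    (Finset.Iic (k + l, 0)).sup (fun m => SchwartzMap.seminorm ℝ m.1 m.2) g with hK
  refine ⟨K, by positivity, fun s x => ?_⟩
  have h := SchwartzMap.one_add_le_sup_seminorm_apply (𝕜 := ℝ) (m := (k + l, 0)) (k := k + l)
    (n := 0) le_rfl le_rfl g (s, x)
  rw [norm_iteratedFDeriv_zero, ← hK] at h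
  rw [mul_assoc, ← mul_inv, ← div_eq_mul_inv, le_div_iff₀ (by positivity), mul_comm]
  refine le_trans ?_ h
  rw [pow_add]
  gcongr
  · exact norm_fst_le (s, x)
  · exact norm_snd_le (s, x)

section Decay

variable {V : Type*} [NormedAddCommGroup V] [NormedSpace ℝ V] [FiniteDimensional ℝ V]
  [MeasurableSpace V] [BorelSpace V] (μ : Measure V) [μ.IsAddHaarMeasure]

theorem integrable_inv_one_add_norm_pow {k : ℕ} (hk : Module.finrank ℝ V < k) :
    Integrable (fun x : V => ((1 + ‖x‖) ^ k)⁻¹) μ := by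
  have h := integrable_one_add_norm (μ := μ) (E := V) (r := k) (by exact_mod_cast hk)
  refine h.congr (.of_forall fun x => ?_)
  simp only
  rw [Real.rpow_neg (by positivity), Real.rpow_natCast]

theorem integrable_memLp_two_of_norm_le_inv_pow {k : ℕ} (hk : Module.finrank ℝ V < k) {u : V → ℝ}
    (hu : AEStronglyMeasurable u μ) {K : ℝ} (hK : ∀ x, ‖u x‖ ≤ K * ((1 + ‖x‖) ^ k)⁻¹) :
    Integrable u μ ∧ MemLp u 2 μ := by
  have h := (integrable_inv_one_add_norm_pow μ hk).const_mul K
  have h1 : Integrable u μ := h.mono' hu (.of_forall hK)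
  refine ⟨h1, (memLp_two_iff_integrable_sq hu).2 ?_⟩
  have hK0 : 0 ≤ K := by simpa using (norm_nonneg _).trans (hK 0)
  have hb : ∀ x, ‖u x‖ ≤ K := fun x => (hK x).trans
    (mul_le_of_le_one_right hK0 (inv_le_one_of_one_le₀ (one_le_pow₀ (by simp))))
  simpa only [sq] using h1.mul_bdd hu (.of_forall hb)

end Decay

theorem exists_productBound {V : Type*} [NormedAddCommGroup V] [InnerProductSpace ℝ V]
    [FiniteDimensional ℝ V] [MeasurableSpace V] [BorelSpace V] {w : V → ℂ} (hw : Measurable w)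
    (hw1 : ∀ x, ‖w x‖ ≤ 1) (g : 𝓢(ℝ × V, ℂ)) :
    ∃ p q, ProductBound (fun z : ℝ × V => w z.2 * g z) p q := by
  set m := Module.finrank ℝ V + 1
  obtain ⟨K, hK, hg⟩ := exists_norm_le_mul_inv_pow g 2 (m + 1)
  have hm : Module.finrank ℝ V < m := Nat.lt_succ_self _
  have hp := integrable_memLp_two_of_norm_le_inv_pow (volume : Measure ℝ) (k := 2)
    (u := fun s => K * ((1 + ‖s‖) ^ 2)⁻¹) (K := K) (by simp)
    (Measurable.aestronglyMeasurable (by fun_prop)) (fun s => by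
      rw [Real.norm_of_nonneg (by positivity)])
  have hq := integrable_memLp_two_of_norm_le_inv_pow (volume : Measure V) (k := m + 1)
    (u := fun x => ((1 + ‖x‖) ^ (m + 1))⁻¹) (K := 1) (hm.trans (Nat.lt_succ_self _))
    (Measurable.aestronglyMeasurable (by fun_prop)) (fun s => by
      rw [Real.norm_of_nonneg (by positivity), one_mul])
  have hq' := integrable_memLp_two_of_norm_le_inv_pow (volume : Measure V) (k := m)
    (u := fun x => ‖x‖ * ((1 + ‖x‖) ^ (m + 1))⁻¹) (K := 1) hm
    (Measurable.aestronglyMeasurable (by fun_prop)) (fun x => by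
      rw [Real.norm_of_nonneg (by positivity), one_mul, pow_succ, mul_inv, mul_left_comm]
      refine mul_le_of_le_one_right (by positivity) ?_
      rw [← div_eq_mul_inv]
      exact div_le_one_of_le₀ (by simp) (by positivity))
  refine ⟨_, _, ⟨?_, fun s x => ?_, hp.1, hp.2, hq.1, hq.2, hq'.1, hq'.2⟩⟩
  · exact ((hw.comp measurable_snd).mul g.continuous.measurable).stronglyMeasurable
  · rw [norm_mul]
    exact (mul_le_of_le_one_left (norm_nonneg _) (hw1 x)).trans (hg s x)

/-- Dual smoothing estimate: for `|w(x)| ≤ ⟨x⟩⁻¹`,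
`‖∫_ℝ e^{-isΔ}(w g(s,·)) ds‖_{L²(ℝⁿ)} ≤ C ‖g‖_{L²(ℝ×ℝⁿ)}`. -/
theorem dual_smoothing_weight (n : ℕ) (hn : 3 ≤ n) :
    ∃ C : ℝ≥0∞, C ≠ ⊤ ∧
      ∀ w : EuclideanSpace ℝ (Fin n) → ℂ, Measurable w →
        (∀ x, ‖w x‖ ≤ (1 + ‖x‖ ^ 2) ^ (-(1 : ℝ) / 2)) →
        ∀ g : 𝓢(ℝ × EuclideanSpace ℝ (Fin n), ℂ),
          eLpNorm (fun x => ∫ s : ℝ, schrod n (-s) (fun y => w y * g (s, y)) x) 2 volume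
            ≤ C * eLpNorm (⇑g) 2 volume := by
  refine ⟨2, ENNReal.ofNat_ne_top, fun w hw hwb g => ?_⟩
  have hsq : ∀ x, (1 + ‖x‖ ^ 2) * ‖w x‖ ^ 2 ≤ 1 := fun x => by
    have h0 : (0 : ℝ) < 1 + ‖x‖ ^ 2 := by positivity
    have h1 : ((1 + ‖x‖ ^ 2) ^ (-(1 : ℝ) / 2)) ^ 2 = (1 + ‖x‖ ^ 2)⁻¹ := by
      rw [← Real.rpow_natCast, ← Real.rpow_mul h0.le, ← Real.rpow_neg_one]
      norm_num
    have h2 : ‖w x‖ ^ 2 ≤ (1 + ‖x‖ ^ 2)⁻¹ := h1 ▸ pow_le_pow_left₀ (norm_nonneg _) (hwb x) 2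
    calc _ ≤ (1 + ‖x‖ ^ 2) * (1 + ‖x‖ ^ 2)⁻¹ := by gcongr
      _ = 1 := mul_inv_cancel₀ h0.ne'
  have hw1 : ∀ x, ‖w x‖ ≤ 1 := fun x => by
    nlinarith [hsq x, norm_nonneg (w x), mul_nonneg (sq_nonneg ‖x‖) (sq_nonneg ‖w x‖)]
  obtain ⟨p, q, hH⟩ := exists_productBound hw hw1 g
  have hweight : ∫⁻ s : ℝ, ∫⁻ x, ENNReal.ofReal (‖x‖ ^ 2) * ‖w x * g (s, x)‖ₑ ^ 2 ≤
      eLpNorm (⇑g) 2 volume ^ 2 := by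
    have hgm : Measurable g := g.continuous.measurable
    rw [← lintegral_enorm_sq_eq, Measure.volume_eq_prod,
      lintegral_prod _ (hgm.enorm.pow_const 2).aemeasurable]
    refine lintegral_mono fun s => lintegral_mono fun x => ?_
    rw [enorm_mul, mul_pow, ← mul_assoc]
    refine mul_le_of_le_one_left' ?_
    rw [← ofReal_norm, ← ENNReal.ofReal_pow (norm_nonneg _), ← ENNReal.ofReal_mul (by positivity)]
    exact ENNReal.ofReal_le_one.2 (by nlinarith [hsq x, sq_nonneg ‖w x‖])
  refine (ENNReal.pow_le_pow_left_iff two_ne_zero).1 ?_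
  rw [mul_pow]
  refine (hH.sq_eLpNorm_integral_schrod_le hn).trans (mul_le_mul' ?_ hweight)
  refine (ENNReal.ofReal_le_ofReal Real.pi_le_four).trans (le_of_eq ?_)
  norm_num
end
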